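/- Let S be a set of n points in general position in generalized double circle configuration. Then the flip graph on the set of all plane spanning paths of S is connected, with diameter O(n^2). -/

import Mathlib

open scoped Classical

noncomputable section

abbrev Pt : Type := ℝ × ℝ

/-- default point -/
def pd : Pt := (0, 0)

/-- No three distinct points of `S` are collinear. -/
def GenPos (S : Finset Pt) : Prop :=
  ∀ p ∈ S, ∀ q ∈ S, ∀ r ∈ S, p ≠ q → p ≠ r → q ≠ r →
    ¬ Collinear ℝ ({p, q, r} : Set Pt)

/-- The (ordered) edges of a path given as a list of vertices. -/
def pathEdges (l : List Pt) : List (Pt × Pt) := l.zip l.tail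

/-- The (ordered) edges of a cycle given as a list of vertices. -/
def cycleEdges (l : List Pt) : List (Pt × Pt) := l.zip (l.rotate 1)

/-- A family of straight-line segments is pairwise non-crossing:
the open segments of any two distinct members are disjoint. -/
def NonCrossing (E : List (Pt × Pt)) : Prop :=
  E.Pairwise fun e f => openSegment ℝ e.1 e.2 ∩ openSegment ℝ f.1 f.2 = ∅

/-- `l` is a plane (crossing-free) straight-line spanning path of `S`. -/
def IsPlanePath (S : Finset Pt) (l : List Pt) : Prop :=
  l.Nodup ∧ l.toFinset = S ∧ NonCrossing (pathEdges l)

/-- `l` is a plane straight-line spanning cycle of `S`. -/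
def IsPlaneCycle (S : Finset Pt) (l : List Pt) : Prop :=
  3 ≤ l.length ∧ l.Nodup ∧ l.toFinset = S ∧ NonCrossing (cycleEdges l)

/-- The set of edges of a path, as unordered pairs. -/
def edgeSet (l : List Pt) : Finset (Sym2 Pt) :=
  ((pathEdges l).map fun e => s(e.1, e.2)).toFinset

/-- The set of edges of a cycle, as unordered pairs. -/
def cycleEdgeSet (l : List Pt) : Finset (Sym2 Pt) :=
  ((cycleEdges l).map fun e => s(e.1, e.2)).toFinset

/-- No segment joining two points of `S` crosses any edge of the cycle `l`. -/
def UncrossedCycle (S : Finset Pt) (l : List Pt) : Prop :=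
  ∀ a ∈ S, ∀ b ∈ S, a ≠ b → ∀ e ∈ cycleEdges l, s(a, b) ≠ s(e.1, e.2) →
    openSegment ℝ a b ∩ openSegment ℝ e.1 e.2 = ∅

/-- Two plane spanning paths of `S` differ by a single flip. -/
def FlipAdj (S : Finset Pt) (P Q : List Pt) : Prop :=
  IsPlanePath S P ∧ IsPlanePath S Q ∧
    ∃ e f, e ≠ f ∧ e ∈ edgeSet P ∧ f ∈ edgeSet Q ∧
      (edgeSet P).erase e = (edgeSet Q).erase f

/-- There is a sequence of `k` flips from `P` to (a representative of) `Q`, all of whose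
members are plane spanning paths of `S` satisfying the additional property `A`. -/
def FlipSeq (S : Finset Pt) (A : List Pt → Prop) (k : ℕ) (P Q : List Pt) : Prop :=
  ∃ f : ℕ → List Pt, f 0 = P ∧ edgeSet (f k) = edgeSet Q ∧
    (∀ i ≤ k, IsPlanePath S (f i) ∧ A (f i)) ∧
    ∀ i < k, FlipAdj S (f i) (f (i + 1))

/-- The flip graph on the plane spanning paths of `S` satisfying `A` is connected. -/
def FlipConnected (S : Finset Pt) (A : List Pt → Prop) : Prop :=
  ∀ P Q : List Pt, IsPlanePath S P → A P → IsPlanePath S Q → A Q →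
    ∃ k, FlipSeq S A k P Q

/-- `uv` is an edge of the boundary of the convex hull of `S`. -/
def HullEdge (S : Finset Pt) (u v : Pt) : Prop :=
  u ∈ S ∧ v ∈ S ∧ u ≠ v ∧ segment ℝ u v ⊆ frontier (convexHull ℝ (S : Set Pt))

/-- `p` is an extreme point (a vertex of the convex hull) of `S`. -/
def ExtremePt (S : Finset Pt) (p : Pt) : Prop :=
  p ∈ S ∧ p ∉ convexHull ℝ ((S.erase p : Finset Pt) : Set Pt)

/-- `p` is a point of `S` lying strictly in the interior of the convex hull of `S`. -/
def InteriorPt (S : Finset Pt) (p : Pt) : Prop :=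
  p ∈ S ∧ p ∈ interior (convexHull ℝ (S : Set Pt))

/-- Twice the signed area of the triangle `a b c` (orientation test). -/
def sign3 (a b c : Pt) : ℝ :=
  (b.1 - a.1) * (c.2 - a.2) - (b.2 - a.2) * (c.1 - a.1)

/-- A finite point set is in convex position. -/
def ConvexPos (C : Finset Pt) : Prop :=
  ∀ x ∈ C, x ∉ convexHull ℝ ((C.erase x : Finset Pt) : Set Pt)

/-- `C` is a concave chain of `S` between the extreme points `p` and `q`:
`C` is in convex position, contains no extreme points of `S` other than `p, q`,
and every line through two points of `C` has all of `S \ C` strictly inside the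
open halfplane containing neither `p` nor `q`. -/
def IsConcaveChain (S C : Finset Pt) (p q : Pt) : Prop :=
  C ⊆ S ∧ p ∈ C ∧ q ∈ C ∧ p ≠ q ∧ ExtremePt S p ∧ ExtremePt S q ∧
  ConvexPos C ∧
  (∀ x ∈ C, ExtremePt S x → x = p ∨ x = q) ∧
  ∀ x ∈ C, ∀ y ∈ C, x ≠ y → ∀ z ∈ S, z ∉ C →
    sign3 x y z ≠ 0 ∧ sign3 x y z * sign3 x y p ≤ 0 ∧ sign3 x y z * sign3 x y q ≤ 0

/-- A generalized double circle structure on `S`: a family of concave chains such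
that every interior point of `S` lies on exactly one chain and every extreme
point of `S` lies on exactly two chains. -/
structure GDCOn (S : Finset Pt) where
  chains : Finset (Finset Pt)
  chains_concave : ∀ C ∈ chains, ∃ p q, IsConcaveChain S C p q
  interior_mem : ∀ x ∈ S, ¬ ExtremePt S x → (chains.filter fun C => x ∈ C).card = 1
  extreme_mem : ∀ x ∈ S, ExtremePt S x → (chains.filter fun C => x ∈ C).card = 2

/-- `xy` is an edge of the hull-boundary path of the chain `C` from `p` to `q`
(an edge of the convex hull boundary of `C` other than the closing edge `pq`,
unless the chain consists of `p` and `q` only). -/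
def ChainEdge (C : Finset Pt) (p q x y : Pt) : Prop :=
  x ∈ C ∧ y ∈ C ∧ x ≠ y ∧
  segment ℝ x y ⊆ frontier (convexHull ℝ (C : Set Pt)) ∧
  (C.card ≤ 2 ∨ s(x, y) ≠ s(p, q))

/-- `u` and `v` are neighbors: consecutive along the spanning cycle formed by
the concave chains of the generalized double circle `g`. -/
def GDCNeighbors {S : Finset Pt} (g : GDCOn S) (u v : Pt) : Prop :=
  ∃ C ∈ g.chains, ∃ p q, IsConcaveChain S C p q ∧ ChainEdge C p q u v

/-- A finite cyclically ordered set with a family of arcs (chains), any two of which share at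
most one point, which is then an end of both. -/
structure ArcConfig (α : Type) where
  S : Finset α
  B : α → α → α → Prop
  chains : Set (Finset α)
  mem : ∀ {a b c}, B a b c → a ∈ S ∧ b ∈ S ∧ c ∈ S
  rot : ∀ {a b c}, B a b c → B b c a
  asymm : ∀ {a b c}, B a b c → ¬ B a c b
  total : ∀ {a b c}, a ∈ S → b ∈ S → c ∈ S → a ≠ b → a ≠ c → b ≠ c → B a b c ∨ B a c b
  trans : ∀ {a b c d}, B a b c → B a c d → B a b d
  sub : ∀ C ∈ chains, C ⊆ S
  contig : ∀ C ∈ chains, ∀ x ∈ C, ∀ y ∈ C, ∀ z ∈ S, ∀ w ∈ S, z ∉ C → w ∉ C →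
    B x z y → ¬ B y w x
  inter : ∀ C ∈ chains, ∀ C' ∈ chains, C ≠ C' → ∀ x ∈ C, x ∈ C' → ∀ y ∈ C, y ∈ C' → x = y
  two : ∀ C ∈ chains, ∀ C' ∈ chains, ∀ C'' ∈ chains, C ≠ C' →
    ∀ y ∈ C, y ∈ C' → y ∈ C'' → C'' = C ∨ C'' = C'
  ends : ∀ C ∈ chains, ∃ p ∈ C, ∃ q ∈ C, p ≠ q ∧
    (∀ x ∈ C, ∀ C' ∈ chains, C' ≠ C → x ∈ C' → x = p ∨ x = q) ∧
    ∀ c ∈ C, ∀ z ∈ S, z ∉ C → c ≠ p → c ≠ q → (B p c q ∧ B q z p) ∨ (B p z q ∧ B q c p)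

namespace ArcConfig

variable {α : Type} (K : ArcConfig α)

lemma rot' {a b c : α} (h : K.B a b c) : K.B c a b := K.rot (K.rot h)

lemma ne {a b c : α} (h : K.B a b c) : a ≠ b ∧ a ≠ c ∧ b ≠ c := by
  have key : ∀ x y, ¬ K.B x y y := fun x y h => K.asymm h h
  refine ⟨?_, ?_, ?_⟩
  · rintro rfl; exact key _ _ (K.rot' h)
  · rintro rfl; exact key _ _ (K.rot h)
  · rintro rfl; exact key _ _ h

/-- The same configuration traversed in the opposite direction. -/
def rev : ArcConfig α where
  S := K.S
  B a b c := K.B c b a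
  chains := K.chains
  mem h := ⟨(K.mem h).2.2, (K.mem h).2.1, (K.mem h).1⟩
  rot h := K.rot' h
  asymm h h' := K.asymm (K.rot' h) (K.rot' h')
  total ha hb hc hab hac hbc := (K.total ha hb hc hab hac hbc).symm.imp
    (fun h => K.rot h) (fun h => K.rot h)
  trans {a b c d} h h' := by
    have h1 : K.B a d c := K.rot' h'
    have h2 : K.B a c b := K.rot' h
    exact K.rot (K.trans h1 h2)
  sub := K.sub
  contig C hC x hx y hy z hz w hw hzC hwC h h' := K.contig C hC y hy x hx z hz w hw hzC hwC h h'
  inter := K.inter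
  two := K.two
  ends C hC := by
    obtain ⟨p, hp, q, hq, hpq, h1, h2⟩ := K.ends C hC
    exact ⟨q, hq, p, hp, hpq.symm, fun x hx C' hC' hne hx' => (h1 x hx C' hC' hne hx').symm,
      fun c hc z hz hzC h h' => h2 c hc z hz hzC h' h⟩

/-- Cyclic betweenness of natural numbers. -/
def Cyc (a b c : ℕ) : Prop := (a < b ∧ b < c) ∨ (b < c ∧ c < a) ∨ (c < a ∧ a < b)

/-- The cyclic order can be cut open at any point. -/
lemma exists_rank {y : α} (hy : y ∈ K.S) : ∃ r : α → ℕ, r y = 0 ∧ (∀ a ∈ K.S, a ≠ y → 0 < r a) ∧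
    (∀ a ∈ K.S, ∀ b ∈ K.S, a ≠ b → r a ≠ r b) ∧
    ∀ a ∈ K.S, ∀ b ∈ K.S, ∀ c ∈ K.S, (K.B a b c ↔ Cyc (r a) (r b) (r c)) := by
  let r : α → ℕ := fun a => if a = y then 0 else (K.S.filter fun c => K.B y c a).card + 1
  have r0 : r y = 0 := by simp [r]
  have rpos : ∀ a ∈ K.S, a ≠ y → 0 < r a := by intro a _ h; simp [r, h]
  have lt : ∀ a b, K.B y a b → r a < r b := by
    intro a b h
    have hn := K.ne h
    simp only [r, if_neg hn.1.symm, if_neg hn.2.1.symm, add_lt_add_iff_right]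
    apply Finset.card_lt_card
    rw [Finset.ssubset_iff_of_subset]
    · refine ⟨a, by simp [(K.mem h).2.1, h], ?_⟩
      intro h'
      exact (K.ne (Finset.mem_filter.1 h').2).2.2 rfl
    · intro c hc
      simp only [Finset.mem_filter] at hc ⊢
      exact ⟨hc.1, K.trans hc.2 h⟩
  have inj : ∀ a ∈ K.S, ∀ b ∈ K.S, a ≠ b → r a ≠ r b := by
    intro a ha b hb hab
    by_cases h1 : a = y
    · subst h1; have := rpos b hb hab.symm; omega
    by_cases h2 : b = y
    · subst h2; have := rpos a ha hab; omega
    rcases K.total hy ha hb (Ne.symm h1) (Ne.symm h2) hab with h | h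
    · exact (lt _ _ h).ne
    · exact (lt _ _ h).ne'
  have lt' : ∀ a ∈ K.S, ∀ b ∈ K.S, a ≠ y → r a < r b → K.B y a b := by
    intro a ha b hb h1 hl
    have h2 : b ≠ y := by rintro rfl; omega
    have h3 : a ≠ b := by rintro rfl; omega
    rcases K.total hy ha hb (Ne.symm h1) (Ne.symm h2) h3 with h | h
    · exact h
    · have := lt _ _ h; omega
  have incr : ∀ a ∈ K.S, ∀ b ∈ K.S, ∀ c ∈ K.S, r a < r b → r b < r c → K.B a b c := by
    intro a ha b hb c hc h1 h2
    by_cases h : a = y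
    · subst h; exact lt' b hb c hc (by rintro rfl; omega) h2
    have h3 := lt' a ha b hb h h1
    have h4 := lt' b hb c hc (by rintro rfl; omega) h2
    exact K.rot' (K.trans (K.rot h4) (K.rot' h3))
  have fwd : ∀ a ∈ K.S, ∀ b ∈ K.S, ∀ c ∈ K.S, Cyc (r a) (r b) (r c) → K.B a b c := by
    rintro a ha b hb c hc (h | h | h)
    · exact incr a ha b hb c hc h.1 h.2
    · exact K.rot' (incr b hb c hc a ha h.1 h.2)
    · exact K.rot (incr c hc a ha b hb h.1 h.2)
  refine ⟨r, r0, rpos, inj, fun a ha b hb c hc => ⟨fun h => ?_, fwd a ha b hb c hc⟩⟩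
  by_contra hn
  have hne := K.ne h
  have := inj a ha b hb hne.1
  have := inj a ha c hc hne.2.1
  have := inj b hb c hc hne.2.2
  refine K.asymm h (fwd a ha c hc b hb ?_)
  unfold Cyc at *
  omega

/-- `b` is the immediate successor of `a`. -/
def Nx (a b : α) : Prop := a ∈ K.S ∧ b ∈ K.S ∧ a ≠ b ∧ ∀ c, ¬ K.B a c b

/-- `a` and `b` are consecutive in the cyclic order. -/
def Nbr (a b : α) : Prop := K.Nx a b ∨ K.Nx b a

/-- `a` and `b` lie on a common chain. -/
def Outer (a b : α) : Prop := ∃ C ∈ K.chains, a ∈ C ∧ b ∈ C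

/-- The pairs `a, b` and `c, d` alternate along the cyclic order. -/
def Alt (a b c d : α) : Prop := (K.B a c b ∧ K.B b d a) ∨ (K.B a d b ∧ K.B b c a)

/-- The segments `ab` and `cd` cross. -/
def X (a b c d : α) : Prop := K.Alt a b c d ∧ (K.Outer a b ↔ K.Outer c d)

lemma nx_rev {a b : α} : K.rev.Nx a b ↔ K.Nx b a := by
  unfold Nx
  constructor
  · rintro ⟨h1, h2, h3, h4⟩; exact ⟨h2, h1, h3.symm, h4⟩
  · rintro ⟨h1, h2, h3, h4⟩; exact ⟨h2, h1, h3.symm, h4⟩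

lemma nbr_rev {a b : α} : K.rev.Nbr a b ↔ K.Nbr a b := by
  unfold Nbr; rw [nx_rev, nx_rev, or_comm]

lemma nbr_comm {a b : α} : K.Nbr a b ↔ K.Nbr b a := or_comm

lemma outer_comm {a b : α} : K.Outer a b ↔ K.Outer b a := by
  unfold Outer; simp only [and_comm]

lemma alt_rev {a b c d : α} : K.rev.Alt a b c d ↔ K.Alt a b c d := by
  unfold Alt rev; simp only; tauto

lemma x_rev {a b c d : α} : K.rev.X a b c d ↔ K.X a b c d := by
  unfold X; rw [alt_rev]; rfl

lemma alt_comm_left {a b c d : α} : K.Alt a b c d ↔ K.Alt b a c d := by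
  unfold Alt; tauto

lemma alt_comm_right {a b c d : α} : K.Alt a b c d ↔ K.Alt a b d c := by
  unfold Alt; tauto

lemma alt_mem {a b c d : α} (h : K.Alt a b c d) : a ∈ K.S ∧ b ∈ K.S ∧ c ∈ K.S ∧ d ∈ K.S := by
  rcases h with ⟨h, h'⟩ | ⟨h, h'⟩
  · exact ⟨(K.mem h).1, (K.mem h).2.2, (K.mem h).2.1, (K.mem h').2.1⟩
  · exact ⟨(K.mem h).1, (K.mem h).2.2, (K.mem h').2.1, (K.mem h).2.1⟩

lemma alt_symm {a b c d : α} (h : K.Alt a b c d) : K.Alt c d a b := by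
  obtain ⟨ha, hb, hc, hd⟩ := K.alt_mem h
  obtain ⟨r, -, -, -, hr⟩ := K.exists_rank ha
  unfold Alt at *
  rw [hr _ ha _ hc _ hb, hr _ hb _ hd _ ha, hr _ ha _ hd _ hb, hr _ hb _ hc _ ha] at h
  rw [hr _ hc _ ha _ hd, hr _ hd _ hb _ hc, hr _ hc _ hb _ hd, hr _ hd _ ha _ hc]
  unfold Cyc at *
  omega

lemma x_symm {a b c d : α} (h : K.X a b c d) : K.X c d a b := ⟨K.alt_symm h.1, h.2.symm⟩

lemma x_comm_left {a b c d : α} : K.X a b c d ↔ K.X b a c d := by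
  unfold X; rw [alt_comm_left, outer_comm]

lemma x_comm_right {a b c d : α} : K.X a b c d ↔ K.X a b d c := by
  unfold X; rw [alt_comm_right, K.outer_comm (a := c)]

lemma not_x_of_nbr {a b c d : α} (h : K.Nbr a b) : ¬ K.X a b c d := by
  rintro ⟨h', -⟩
  rcases h with h | h
  · rcases h' with h' | h'
    · exact h.2.2.2 _ h'.1
    · exact h.2.2.2 _ h'.1
  · rcases h' with h' | h'
    · exact h.2.2.2 _ h'.2
    · exact h.2.2.2 _ h'.2

lemma not_x_of_nbr' {a b c d : α} (h : K.Nbr c d) : ¬ K.X a b c d :=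
  fun h' => K.not_x_of_nbr h (K.x_symm h')

/-- Moving one endpoint of a segment to a neighbor on the cycle without changing its side creates
no crossings, apart from those with segments at the old endpoint. -/
lemma not_x_shift {u v y c d : α} (huv : K.Nbr u v) (hyu : y ≠ u) (hyv : y ≠ v)
    (ht : K.Outer v y ↔ K.Outer u y) (hc : c ≠ u) (hd : d ≠ u) (h : ¬ K.X u y c d) :
    ¬ K.X v y c d := by
  intro hx
  apply h
  refine ⟨?_, ht.symm.trans hx.2⟩
  obtain ⟨hv, hy, hcS, hdS⟩ := K.alt_mem hx.1
  have hu : u ∈ K.S := by rcases huv with h | h; exacts [h.1, h.2.1]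
  have hx := hx.1
  obtain ⟨r, r0, rp, ri, hr⟩ := K.exists_rank hy
  have h1 := ri _ hcS _ hu hc
  have h2 := ri _ hdS _ hu hd
  have h3 := rp _ hu hyu.symm
  have h4 := rp _ hv hyv.symm
  unfold Alt at *
  rw [hr _ hv _ hcS _ hy, hr _ hy _ hdS _ hv, hr _ hv _ hdS _ hy, hr _ hy _ hcS _ hv] at hx
  rw [hr _ hu _ hcS _ hy, hr _ hy _ hdS _ hu, hr _ hu _ hdS _ hy, hr _ hy _ hcS _ hu]
  have key : ¬ Cyc (r u) (r c) (r v) ∧ ¬ Cyc (r u) (r d) (r v) ∧ ¬ Cyc (r u) (r y) (r v) ∨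
      ¬ Cyc (r v) (r c) (r u) ∧ ¬ Cyc (r v) (r d) (r u) ∧ ¬ Cyc (r v) (r y) (r u) := by
    rcases huv with h | h
    · left
      rw [← hr _ hu _ hcS _ hv, ← hr _ hu _ hdS _ hv, ← hr _ hu _ hy _ hv]
      exact ⟨h.2.2.2 _, h.2.2.2 _, h.2.2.2 _⟩
    · right
      rw [← hr _ hv _ hcS _ hu, ← hr _ hv _ hdS _ hu, ← hr _ hv _ hy _ hu]
      exact ⟨h.2.2.2 _, h.2.2.2 _, h.2.2.2 _⟩
  clear hr ri rp
  simp only [Cyc, r0, not_lt_zero, false_and, and_false, false_or, or_false] at *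
  rcases key with key | key <;> rcases hx with hx | hx
  · left; omega
  · right; omega
  · left; omega
  · right; omega

lemma nx_unique {a b c : α} (h : K.Nx a b) (h' : K.Nx a c) : b = c := by
  by_contra hn
  rcases K.total h.1 h.2.1 h'.2.1 h.2.2.1 h'.2.2.1 hn with h1 | h1
  · exact h'.2.2.2 _ h1
  · exact h.2.2.2 _ h1

lemma nx_unique' {a b c : α} (h : K.Nx b a) (h' : K.Nx c a) : b = c :=
  K.rev.nx_unique (K.nx_rev.2 h) (K.nx_rev.2 h')

lemma exists_nx {a b : α} (ha : a ∈ K.S) (hb : b ∈ K.S) (hab : a ≠ b) : ∃ c, K.Nx a c := by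
  obtain ⟨r, r0, rp, ri, hr⟩ := K.exists_rank ha
  obtain ⟨c, hc, hmin⟩ := Finset.exists_min_image (K.S.erase a) r ⟨b, by simp [hb, hab.symm]⟩
  rw [Finset.mem_erase] at hc
  refine ⟨c, ha, hc.2, hc.1.symm, fun d hd => ?_⟩
  have hdS := (K.mem hd).2.1
  have := hmin d (by simp [hdS, (K.ne hd).1.symm])
  rw [hr _ ha _ hdS _ hc.2] at hd
  have := rp _ hc.2 hc.1
  unfold Cyc at hd
  omega

lemma not_x_self {a b d : α} : ¬ K.X a b a d := by
  rintro ⟨h | h, -⟩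
  · exact (K.ne h.1).1 rfl
  · exact (K.ne h.2).2.2 rfl

lemma not_x_self' {a b d : α} : ¬ K.X a b d a := fun h => K.not_x_self (K.x_comm_right.1 h)

/-- `x` and `y` are consecutive in a list, in either order. -/
def Ed : List α → α → α → Prop
  | a :: b :: t, x, y => (x = a ∧ y = b ∨ x = b ∧ y = a) ∨ Ed (b :: t) x y
  | _, _, _ => False

/-- `x` and `y` are the two endpoints, in either order, of the edge joining two lists. -/
def Link (A B : List α) (x y : α) : Prop :=
  ∃ z v, A.getLast? = some z ∧ B.head? = some v ∧ (x = z ∧ y = v ∨ x = v ∧ y = z)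

lemma ed_append (A B : List α) (x y : α) :
    Ed (A ++ B) x y ↔ Ed A x y ∨ Ed B x y ∨ Link A B x y := by
  induction A with
  | nil => simp [Ed, Link]
  | cons a A ih =>
    cases A with
    | nil =>
      cases B with
      | nil => simp [Ed, Link]
      | cons b B => simp [Ed, Link]; tauto
    | cons a' A =>
      have h1 : Link (a :: a' :: A) B x y ↔ Link (a' :: A) B x y := by
        simp [Link, List.getLast?_cons_cons]
      simp only [List.cons_append, Ed] at ih ⊢
      rw [ih, h1]; tauto

lemma ed_reverse (l : List α) (x y : α) : Ed l.reverse x y ↔ Ed l x y := by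
  induction l with
  | nil => simp
  | cons a l ih =>
    rw [List.reverse_cons, ed_append, ih]
    cases l with
    | nil => simp [Ed, Link]
    | cons b l => simp [Ed, Link]; tauto

lemma ed_mem {l : List α} {x y : α} (h : Ed l x y) : x ∈ l ∧ y ∈ l := by
  induction l with
  | nil => exact h.elim
  | cons a l ih =>
    cases l with
    | nil => exact h.elim
    | cons b l =>
      rcases h with (⟨rfl, rfl⟩ | ⟨rfl, rfl⟩) | h
      · simp
      · simp
      · exact ⟨List.mem_cons_of_mem _ (ih h).1, List.mem_cons_of_mem _ (ih h).2⟩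

/-- The weight of an edge: `0` on the cycle, `1` for a chord. -/
def wt (z v : α) : ℕ := if K.Nbr z v then 0 else 1

/-- The weight of the edge joining two lists. -/
def lnk : Option α → Option α → ℕ
  | some z, some v => K.wt z v
  | _, _ => 0

/-- The number of chords on a path. -/
def chd : List α → ℕ
  | a :: b :: t => K.wt a b + chd (b :: t)
  | _ => 0

lemma wt_comm (a b : α) : K.wt a b = K.wt b a := by
  unfold wt; simp only [K.nbr_comm]

lemma wt_rev (a b : α) : K.rev.wt a b = K.wt a b := by
  unfold wt; simp only [K.nbr_rev]

lemma wt_nbr {a b : α} (h : K.Nbr a b) : K.wt a b = 0 := by simp [wt, h]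

lemma wt_chord {a b : α} (h : ¬ K.Nbr a b) : K.wt a b = 1 := by simp [wt, h]

lemma chd_rev (l : List α) : K.rev.chd l = K.chd l := by
  induction l with
  | nil => rfl
  | cons a l ih =>
    cases l with
    | nil => rfl
    | cons b l => simp only [chd, ih, wt_rev]

lemma chd_append (A B : List α) :
    K.chd (A ++ B) = K.chd A + K.chd B + K.lnk A.getLast? B.head? := by
  induction A with
  | nil => simp [chd, lnk]
  | cons a A ih =>
    cases A with
    | nil =>
      cases B with
      | nil => simp [chd, lnk]
      | cons b B => simp [chd, lnk]; ring
    | cons a' A =>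
      simp only [List.cons_append, chd, List.getLast?_cons_cons] at ih ⊢
      rw [ih]; ring

lemma chd_reverse (l : List α) : K.chd l.reverse = K.chd l := by
  induction l with
  | nil => rfl
  | cons a l ih =>
    rw [List.reverse_cons, chd_append, ih]
    cases l with
    | nil => simp [chd, lnk]
    | cons b l => simp [chd, lnk, K.wt_comm]; ring

/-- A crossing-free spanning path. -/
def Good (l : List α) : Prop :=
  l.Nodup ∧ (∀ x, x ∈ l ↔ x ∈ K.S) ∧ ∀ a b c d, Ed l a b → Ed l c d → ¬ K.X a b c d

/-- Two crossing-free spanning paths that differ by reversing an initial part or by exchanging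
an initial part with the rest. -/
def Step (l l' : List α) : Prop :=
  K.Good l ∧ K.Good l' ∧ ∃ A B, l = A ++ B ∧ (l' = A.reverse ++ B ∨ l' = B ++ A)

/-- `l'` is reached from `l` in at most `k` steps. -/
inductive Reach : ℕ → List α → List α → Prop
  | refl (k : ℕ) (l : List α) : Reach k l l
  | step {k : ℕ} {l l' l'' : List α} : K.Step l l' → Reach k l' l'' → Reach (k + 1) l l''

lemma good_rev {l : List α} : K.rev.Good l ↔ K.Good l := by
  unfold Good; simp only [x_rev]; rfl

lemma step_rev {l l' : List α} : K.rev.Step l l' ↔ K.Step l l' := by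
  unfold Step; simp only [good_rev]

variable {K}

lemma Reach.mono {k m : ℕ} {l l' : List α} (h : K.Reach k l l') (hkm : k ≤ m) :
    K.Reach m l l' := by
  induction h generalizing m with
  | refl => exact .refl _ _
  | step h1 h2 ih =>
    obtain ⟨m, rfl⟩ : ∃ m', m = m' + 1 := ⟨m - 1, by omega⟩
    exact .step h1 (ih (by omega))

lemma Reach.trans {k m : ℕ} {l l' l'' : List α} (h : K.Reach k l l') (h' : K.Reach m l' l'') :
    K.Reach (k + m) l l'' := by
  induction h with
  | refl => exact h'.mono (by omega)
  | step h1 h2 ih => rw [add_right_comm]; exact .step h1 (ih h')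

lemma reach_rev {k : ℕ} {l l' : List α} (h : K.rev.Reach k l l') : K.Reach k l l' := by
  induction h with
  | refl => exact .refl _ _
  | step h1 h2 ih => exact .step (K.step_rev.1 h1) ih

variable (K)

/-- A path with fewer than `c` chords is reached from `l` in at most `k` steps. -/
def Gain (k c : ℕ) (l : List α) : Prop := ∃ l', K.Reach k l l' ∧ K.Good l' ∧ K.chd l' < c

variable {K}

lemma Gain.mono {k m c : ℕ} {l : List α} (h : K.Gain k c l) (hkm : k ≤ m) : K.Gain m c l := by
  obtain ⟨l', h1, h2⟩ := h
  exact ⟨l', h1.mono hkm, h2⟩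

lemma Gain.step {k c : ℕ} {l l' : List α} (hs : K.Step l l') (h : K.Gain k c l') :
    K.Gain (k + 1) c l := by
  obtain ⟨m, h1, h2⟩ := h
  exact ⟨m, .step hs h1, h2⟩

lemma gain_of_step {c : ℕ} {l l' : List α} (hs : K.Step l l') (h : K.chd l' < c) :
    K.Gain 1 c l := Gain.step (k := 0) hs ⟨l', .refl _ _, hs.2.1, h⟩

lemma gain_rev {k c : ℕ} {l : List α} (h : K.rev.Gain k c l) : K.Gain k c l := by
  obtain ⟨l', h1, h2, h3⟩ := h
  exact ⟨l', reach_rev h1, K.good_rev.1 h2, by rwa [chd_rev] at h3⟩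

variable (K)

lemma good_of_edges {l l' : List α} {s v : α} (hl : K.Good l) (hp : l'.Perm l)
    (he : ∀ x y, Ed l' x y → (x = s ∧ y = v ∨ x = v ∧ y = s) ∨
      (Ed l x y ∧ ¬ K.X s v x y)) : K.Good l' := by
  refine ⟨hp.nodup_iff.2 hl.1, fun x => (hp.mem_iff).trans (hl.2.1 x), ?_⟩
  intro a b c d h1 h2 hx
  rcases he a b h1 with (⟨rfl, rfl⟩ | ⟨rfl, rfl⟩) | ⟨h1, h1'⟩ <;>
  rcases he c d h2 with (⟨rfl, rfl⟩ | ⟨rfl, rfl⟩) | ⟨h2, h2'⟩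
  · exact K.not_x_self hx
  · exact K.not_x_self' hx
  · exact h2' hx
  · exact K.not_x_self' hx
  · exact K.not_x_self hx
  · exact h2' (K.x_comm_left.1 hx)
  · exact h1' (K.x_symm hx)
  · exact h1' (K.x_symm (K.x_comm_right.1 hx))
  · exact hl.2.2 _ _ _ _ h1 h2 hx

lemma step_reverse {A B : List α} {s v : α} (hl : K.Good (A ++ B)) (hs : A.head? = some s)
    (hv : B.head? = some v) (h : ∀ c d, Ed A c d ∨ Ed B c d → ¬ K.X s v c d) :
    K.Step (A ++ B) (A.reverse ++ B) := by
  refine ⟨hl, ?_, A, B, rfl, .inl rfl⟩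
  refine K.good_of_edges (s := s) (v := v) hl ((List.reverse_perm A).append_right B) ?_
  intro x y hxy
  rw [ed_append, ed_reverse] at hxy
  rw [ed_append]
  rcases hxy with h1 | h1 | ⟨z, w, h1, h2, h3⟩
  · exact .inr ⟨.inl h1, h _ _ (.inl h1)⟩
  · exact .inr ⟨.inr (.inl h1), h _ _ (.inr h1)⟩
  · left
    rw [List.getLast?_reverse, hs] at h1
    rw [hv] at h2
    cases h1; cases h2; exact h3

lemma step_rotate {A B : List α} {s v : α} (hl : K.Good (A ++ B)) (hs : A.head? = some s)
    (hv : B.getLast? = some v) (h : K.Nbr v s) : K.Step (A ++ B) (B ++ A) := by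
  refine ⟨hl, ?_, A, B, rfl, .inr rfl⟩
  refine K.good_of_edges (s := v) (v := s) hl List.perm_append_comm ?_
  intro x y hxy
  rw [ed_append] at hxy
  rw [ed_append]
  rcases hxy with h1 | h1 | ⟨z, w, h1, h2, h3⟩
  · exact .inr ⟨.inr (.inl h1), K.not_x_of_nbr h⟩
  · exact .inr ⟨.inl h1, K.not_x_of_nbr h⟩
  · left
    rw [hs] at h2
    rw [hv] at h1
    cases h1; cases h2; exact h3

lemma step_reverse_nbr {A B : List α} {s v : α} (hl : K.Good (A ++ B)) (hs : A.head? = some s)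
    (hv : B.head? = some v) (h : K.Nbr s v) : K.Step (A ++ B) (A.reverse ++ B) :=
  K.step_reverse hl hs hv fun _ _ _ => K.not_x_of_nbr h

lemma Good.reverse {l : List α} (hl : K.Good l) : K.Good l.reverse := by
  refine ⟨List.nodup_reverse.2 hl.1, fun x => by rw [List.mem_reverse]; exact hl.2.1 x, ?_⟩
  simp only [ed_reverse]
  exact hl.2.2

lemma step_reverse_all {l : List α} (hl : K.Good l) : K.Step l l.reverse :=
  ⟨hl, Good.reverse K hl, l, [], by simp, .inl (by simp)⟩

/-- If the last vertex is a neighbor of the first one, then a chord can be removed. -/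
lemma gain_of_closed {l : List α} {s v : α} (hl : K.Good l) (hs : l.head? = some s)
    (hv : l.getLast? = some v) (h : K.Nbr v s) (hc : 0 < K.chd l) : K.Gain 1 (K.chd l) l := by
  have key : ∀ l : List α, 0 < K.chd l → ∃ A B a b, l = (A ++ [a]) ++ b :: B ∧ ¬ K.Nbr a b := by
    intro l
    induction l with
    | nil => simp [chd]
    | cons a l ih =>
      cases l with
      | nil => simp [chd]
      | cons b l =>
        intro hc
        by_cases hab : K.Nbr a b
        · simp only [chd, K.wt_nbr hab, zero_add] at hc
          obtain ⟨A, B, a', b', h1, h2⟩ := ih hc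
          exact ⟨a :: A, B, a', b', by simp [h1], h2⟩
        · exact ⟨[], l, a, b, by simp, hab⟩
  obtain ⟨A, B, a, b, rfl, hab⟩ := key l hc
  rw [List.getLast?_append_of_ne_nil _ (by simp)] at hv
  rw [List.head?_append_of_ne_nil _ (by simp)] at hs
  refine gain_of_step (K.step_rotate hl hs hv h) ?_
  rw [chd_append, chd_append _ (A ++ [a]), hs, hv]
  simp [lnk, K.wt_nbr h, K.wt_chord hab]
  omega

/-- Transitivity for the last three of four cyclically ordered points. -/
lemma trans' {a b c d : α} (h : K.B a b c) (h' : K.B a c d) : K.B b c d := by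
  have h1 := K.trans h h'
  rcases K.total (K.mem h).2.1 (K.mem h).2.2 (K.mem h').2.2 (K.ne h).2.2 (K.ne h1).2.2
    (K.ne h').2.2 with h2 | h2
  · exact h2
  · exact (K.asymm (K.rot h') (K.trans (K.rot' h) (K.rot' h2))).elim

lemma arc_left {s s' w v : α} (h : K.Nx s s') (hw : w ∈ K.S) (hs : w ≠ s) (hs' : w ≠ s') :
    K.B s v w ↔ v = s' ∨ K.B s' v w := by
  have h0 : K.B s s' w :=
    (K.total h.1 h.2.1 hw h.2.2.1 hs.symm hs'.symm).resolve_right (h.2.2.2 _)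
  constructor
  · intro h1
    refine or_iff_not_imp_left.2 fun hv => ?_
    exact K.trans' ((K.total h.1 h.2.1 (K.mem h1).2.1 h.2.2.1 (K.ne h1).1
      (Ne.symm hv)).resolve_right (h.2.2.2 _)) h1
  · rintro (rfl | h1)
    · exact h0
    · exact K.rot (K.trans (K.rot' h0) (K.rot' h1))

lemma arc_right {s s' w v : α} (h : K.Nx s s') (hw : w ∈ K.S) (hs : w ≠ s) (hs' : w ≠ s') :
    K.B w v s' ↔ v = s ∨ K.B w v s :=
  K.rev.arc_left (K.nx_rev.2 h) hw hs' hs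

/-- Reversing the initial part `P, u`, where `u` is joined to a neighbor on the cycle and the
first vertex is the other neighbor of `u`. -/
lemma step_shift {P D : List α} {t u v y : α} (hl : K.Good ((P ++ [u]) ++ y :: D))
    (hv : P.head? = some v) (ht : P.getLast? = some t) (htu : K.Nbr t u) (huv : K.Nbr u v)
    (ho : K.Outer v y ↔ K.Outer u y) :
    K.Step ((P ++ [u]) ++ y :: D) ((P ++ [u]).reverse ++ y :: D) := by
  have hP : P ≠ [] := by rintro rfl; simp at hv
  have hnd := hl.1
  have hvP := List.mem_of_mem_head? hv
  simp only [List.append_assoc, List.nodup_append, List.cons_append, List.nil_append,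
    List.nodup_cons, List.mem_cons] at hnd
  have hyu : y ≠ u := fun h => hnd.2.1.1 (.inl h.symm)
  have hyv : y ≠ v := fun h => hnd.2.2 v hvP y (by simp) h.symm
  have huy : ¬ u ∈ y :: D := by simpa using hnd.2.1.1
  have huP : ¬ u ∈ P := fun h => hnd.2.2 u h u (by simp) rfl
  refine K.step_reverse hl (s := v) (v := y) (by simp [List.head?_append, hv]) rfl ?_
  intro c d h
  have huyX : ∀ c d, Ed (P ++ [u]) c d ∨ Ed (y :: D) c d → ¬ K.X u y c d := by
    intro c d h
    refine hl.2.2 _ _ _ _ ?_ ?_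
    · rw [ed_append]; right; right; exact ⟨u, y, by simp, rfl, .inl ⟨rfl, rfl⟩⟩
    · rw [ed_append]; tauto
  have hX := huyX c d h
  have main : c ≠ u → d ≠ u → ¬ K.X v y c d := fun hc hd =>
    K.not_x_shift huv hyu hyv ho hc hd hX
  rcases h with h | h
  · rw [ed_append] at h
    rcases h with h | h | ⟨z, w, h1, h2, h3⟩
    · have := ed_mem h
      exact main (fun h => huP (h ▸ this.1)) (fun h => huP (h ▸ this.2))
    · exact h.elim
    · rw [ht] at h1
      cases h1
      simp only [List.head?_cons, Option.some.injEq] at h2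
      subst h2
      rcases h3 with ⟨rfl, rfl⟩ | ⟨rfl, rfl⟩
      · exact K.not_x_of_nbr' htu
      · exact K.not_x_of_nbr' (K.nbr_comm.1 htu)
  · have := ed_mem h
    exact main (fun h => huy (h ▸ this.1)) (fun h => huy (h ▸ this.2))

lemma nbr_cases {z s s' : α} (h : K.Nbr z s') (h' : K.Nx s s') (hz : z ≠ s) : K.Nx s' z :=
  h.resolve_left fun h => hz (K.nx_unique' h h')

lemma not_nbr_of_nx {z s s' y : α} (h : K.Nx s s') (h' : K.Nx s' z) (hy : y ≠ s) (hy' : y ≠ z) :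
    ¬ K.Nbr s' y := by
  rintro (h1 | h1)
  · exact hy' (K.nx_unique h1 h')
  · exact hy (K.nx_unique' h1 h)

lemma gain_of_chord_end {A D : List α} {s s' z : α} (hl : K.Good ((s :: A ++ [z]) ++ s' :: D))
    (h : K.Nbr s s') (hz : ¬ K.Nbr z s') :
    K.Gain 1 (K.chd ((s :: A ++ [z]) ++ s' :: D)) ((s :: A ++ [z]) ++ s' :: D) := by
  refine gain_of_step (K.step_reverse_nbr hl (s := s) (v := s') (by simp) rfl h) ?_
  rw [chd_append, chd_append _ (s :: A ++ [z]), chd_reverse,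
    show (s :: A ++ [z]).reverse.getLast? = some s by rw [List.getLast?_reverse]; rfl,
    show (s :: A ++ [z]).getLast? = some z by rw [List.getLast?_append]; rfl]
  simp [lnk, K.wt_nbr h, K.wt_chord hz]

lemma alpha (m c : ℕ) : ∀ (A D : List α) (s s' y : α), K.Good ((s :: A) ++ s' :: y :: D) →
    A ≠ [] → K.Nx s s' → (K.S.filter fun v => K.B s v y).card ≤ m →
    K.chd ((s :: A) ++ s' :: y :: D) ≤ c →
    K.Gain (2 * m + 2) c ((s :: A) ++ s' :: y :: D) ∨
    ∃ A1 w W, A = A1 ++ w :: W ∧ (∀ v, K.B s v w ↔ v = s' ∨ v ∈ W) ∧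
      ¬ (K.Outer w y ↔ K.Outer s' y) := by
  induction m with
  | zero =>
    intro A D s s' y hl hA hs hm hc
    exfalso
    have hnd := hl.1
    simp only [List.nodup_append, List.nodup_cons, List.mem_cons, List.mem_append,
      List.cons_append, not_or] at hnd
    have hy : y ∈ K.S := (hl.2.1 _).1 (by simp)
    have : s' ∈ (K.S.filter fun v => K.B s v y) := by
      simp only [Finset.mem_filter]
      exact ⟨hs.2.1, (K.arc_left hs hy (by rintro rfl; tauto) (by rintro rfl; tauto)).2 (.inl rfl)⟩
    simp only [Nat.le_zero, Finset.card_eq_zero] at hm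
    simp [hm] at this
  | succ m ih =>
    intro A D s s' y hl hA hs hm hc
    obtain ⟨A, z, rfl⟩ : ∃ A' z, A = A' ++ [z] :=
      ⟨_, _, (List.dropLast_append_getLast hA).symm⟩
    have hnd := hl.1
    simp only [List.nodup_append, List.nodup_cons, List.mem_cons, List.mem_append,
      List.cons_append, List.not_mem_nil, or_false, not_or] at hnd
    have hy : y ∈ K.S := (hl.2.1 _).1 (by simp)
    have hys : y ≠ s := by rintro rfl; tauto
    have hys' : y ≠ s' := by rintro rfl; tauto
    have hyz : y ≠ z := by rintro rfl; grind
    have hzs : z ≠ s := by rintro rfl; tauto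
    have hyA : y ∉ A := by grind
    by_cases hz : K.Nbr z s'
    swap
    · left
      obtain ⟨l', h1, h2, h3⟩ := (K.gain_of_chord_end (A := A) hl (.inl hs) hz)
      exact ⟨l', h1.mono (by omega), h2, by
        rw [show s :: (A ++ [z]) = s :: A ++ [z] from rfl] at hc; omega⟩
    have hz' := K.nbr_cases hz hs hzs
    by_cases ho : K.Outer z y ↔ K.Outer s' y
    swap
    · right
      refine ⟨A, z, [], rfl, fun v => ?_, ho⟩
      rw [K.arc_left hs hz'.2.1 hzs hz'.2.2.1.symm]
      simp [hz'.2.2.2 v]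
    have st1 := K.step_reverse_nbr hl (s := s) (v := s') rfl rfl (.inl hs)
    have e1 : (s :: (A ++ [z])).reverse ++ s' :: y :: D =
      (((s :: (A ++ [z])).reverse) ++ [s']) ++ y :: D := by simp
    rw [e1] at st1
    have st2 := K.step_shift st1.2.1 (v := z) (t := s) (by simp)
      (by rw [List.getLast?_reverse]; rfl) (.inl hs) (.inl hz') ho
    have e2 : ((s :: (A ++ [z])).reverse ++ [s']).reverse ++ y :: D =
      (s' :: s :: A) ++ z :: y :: D := by simp
    rw [e2] at st2
    have hch : K.chd ((s' :: s :: A) ++ z :: y :: D) ≤ c := by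
      refine le_trans ?_ hc
      have e3 : s :: (A ++ [z]) ++ s' :: y :: D = (s :: A) ++ z :: s' :: y :: D := by simp
      rw [e3, chd_append, chd_append _ (s :: A)]
      have w1 := K.wt_nbr (.inr hs : K.Nbr s' s)
      have w2 := K.wt_nbr hz
      have w3 := K.wt_chord (K.not_nbr_of_nx hs hz' hys hyz)
      have w4 : K.wt z y ≤ 1 := by unfold wt; split_ifs <;> simp
      simp only [chd, List.head?_cons, List.getLast?_cons_cons]
      omega
    have hm' : (K.S.filter fun v => K.B s' v y).card ≤ m := by
      have : (K.S.filter fun v => K.B s' v y) ⊂ (K.S.filter fun v => K.B s v y) := by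
        rw [Finset.ssubset_iff_of_subset]
        · refine ⟨s', ?_, ?_⟩
          · simp only [Finset.mem_filter]
            exact ⟨hs.2.1, (K.arc_left hs hy hys hys').2 (.inl rfl)⟩
          · simp only [Finset.mem_filter, not_and]
            exact fun _ h => (K.ne h).1 rfl
        · intro v
          simp only [Finset.mem_filter]
          exact fun h => ⟨h.1, (K.arc_left hs hy hys hys').2 (.inr h.2)⟩
      have := Finset.card_lt_card this
      omega
    rcases ih (s :: A) D s' z y st2.2.1 (by simp) hz' hm' hch with hg | ⟨A1, w, W, h1, h2, h3⟩
    · left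
      exact ((hg.step st2).step st1).mono (by omega)
    · right
      cases A1 with
      | nil =>
        exfalso
        simp only [List.nil_append, List.cons.injEq] at h1
        obtain ⟨rfl, rfl⟩ := h1
        have h4 : K.B s' y s :=
          (K.total hs.2.1 hy hs.1 hys'.symm hs.2.2.1.symm hys).resolve_right
            (fun h => hs.2.2.2 _ (K.rot h))
        rcases (h2 y).1 h4 with h | h
        · exact hyz h
        · exact hyA h
      | cons a A1 =>
        simp only [List.cons_append, List.cons.injEq] at h1
        obtain ⟨rfl, rfl⟩ := h1
        have hwA : w ∈ A1 ++ w :: W := by simp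
        have hws : w ≠ s := by rintro rfl; tauto
        have hws' : w ≠ s' := by rintro rfl; grind
        have hwS : w ∈ K.S := (hl.2.1 _).1 (by simp)
        refine ⟨A1, w, W ++ [z], by simp, fun v => ?_, by rw [← ho]; exact h3⟩
        rw [K.arc_left hs hwS hws hws', h2]
        simp; tauto

lemma gamma (m c : ℕ) : ∀ (A D : List α) (s s' y : α), K.Good ((s :: A) ++ s' :: y :: D) →
    A ≠ [] → K.Nx s s' → (K.S.filter fun v => K.B y v s').card ≤ m →
    K.chd ((s :: A) ++ s' :: y :: D) ≤ c →
    K.Gain (2 * m + 2) c ((s :: A) ++ s' :: y :: D) ∨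
    ∃ W w A2, s :: A = W ++ w :: A2 ∧ (∀ v, K.B w v s' ↔ v ∈ W) ∧
      ¬ (K.Outer w y ↔ K.Outer s' y) := by
  induction m with
  | zero =>
    intro A D s s' y hl hA hs hm hc
    exfalso
    have hnd := hl.1
    simp only [List.nodup_append, List.nodup_cons, List.mem_cons, List.mem_append,
      List.cons_append, not_or] at hnd
    have hy : y ∈ K.S := (hl.2.1 _).1 (by simp)
    have : s ∈ (K.S.filter fun v => K.B y v s') := by
      simp only [Finset.mem_filter]
      exact ⟨hs.1, (K.arc_right hs hy (by rintro rfl; tauto) (by rintro rfl; tauto)).2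
        (.inl rfl)⟩
    simp only [Nat.le_zero, Finset.card_eq_zero] at hm
    simp [hm] at this
  | succ m ih =>
    intro A D s s' y hl hA hs hm hc
    obtain ⟨A', z, hAz⟩ : ∃ A' z, A = A' ++ [z] :=
      ⟨_, _, (List.dropLast_append_getLast hA).symm⟩
    have hzA : z ∈ A := by simp [hAz]
    obtain ⟨a, A3, rfl⟩ := List.exists_cons_of_ne_nil hA
    have hnd := hl.1
    simp only [List.nodup_append, List.nodup_cons, List.mem_cons, List.mem_append,
      List.cons_append, not_or] at hnd
    have hy : y ∈ K.S := (hl.2.1 _).1 (by simp)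
    have hys : y ≠ s := by rintro rfl; tauto
    have hys' : y ≠ s' := by rintro rfl; tauto
    have hzs : z ≠ s := by rintro rfl; simp at hzA; tauto
    have hya : y ≠ a := by rintro rfl; tauto
    have hsa : a ≠ s := by rintro rfl; tauto
    have hs'a : a ≠ s' := by rintro rfl; tauto
    have hyA : y ∉ A3 := by grind
    by_cases hz : K.Nbr z s'
    swap
    · left
      rw [hAz] at hl hc ⊢
      obtain ⟨l', h1, h2, h3⟩ := (K.gain_of_chord_end (A := A') hl (.inl hs) hz)
      exact ⟨l', h1.mono (by omega), h2, by
        rw [show s :: (A' ++ [z]) = s :: A' ++ [z] from rfl] at hc; omega⟩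
    have hz' := K.nbr_cases hz hs hzs
    have hyz : y ≠ z := by rintro rfl; simp at hzA; tauto
    by_cases ho : K.Outer s y ↔ K.Outer s' y
    swap
    · right
      exact ⟨[], s, a :: A3, rfl, fun v => by simp [hs.2.2.2 v], ho⟩
    have e0 : (s :: a :: A3) ++ s' :: y :: D = ((s :: a :: A3) ++ [s']) ++ y :: D := by simp
    have hl' := hl
    rw [e0] at hl'
    have st1 := K.step_shift hl' (v := s) (t := z) (by simp)
      (by rw [hAz, ← List.cons_append, List.getLast?_append]; rfl) hz (.inr hs) ho
    have e1 : (s :: a :: A3 ++ [s']).reverse ++ y :: D =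
      (s' :: (a :: A3).reverse) ++ s :: y :: D := by simp
    rw [e1, ← e0] at st1
    have st2 := K.step_reverse_nbr st1.2.1 (s := s') (v := s) rfl rfl (.inr hs)
    have e2 : (s' :: (a :: A3).reverse).reverse ++ s :: y :: D =
      (a :: (A3 ++ [s'])) ++ s :: y :: D := by simp
    rw [e2] at st2
    have w1 := K.wt_nbr (.inr hs : K.Nbr s' s)
    have w2 := K.wt_nbr hz
    have w3 := K.wt_chord (K.not_nbr_of_nx hs hz' hys hyz)
    have w4 : K.wt s y ≤ 1 := by unfold wt; split_ifs <;> simp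
    have hch0 : K.chd ((s :: a :: A3) ++ s' :: y :: D) =
        K.wt s a + K.chd (a :: A3) + K.chd (y :: D) + 1 := by
      rw [chd_append, show (s :: a :: A3).getLast? = some z by
        rw [hAz, ← List.cons_append, List.getLast?_append]; rfl]
      simp only [chd, lnk, List.head?_cons]
      omega
    have hch1 : K.chd ((a :: (A3 ++ [s'])) ++ s :: y :: D) =
        K.chd (a :: A3) + K.chd (y :: D) + K.wt s y := by
      rw [show (a :: (A3 ++ [s'])) ++ s :: y :: D = (a :: A3) ++ s' :: s :: y :: D by simp,
        chd_append, show (a :: A3).getLast? = some z by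
        rw [hAz, List.getLast?_append]; rfl]
      simp only [chd, lnk, List.head?_cons]
      omega
    by_cases ha : K.Nbr a s
    swap
    · left
      have w5 := K.wt_chord ha
      rw [K.wt_comm] at w5
      exact ((gain_of_step st2 (by omega)).step st1).mono (by omega)
    have ha' : K.Nx a s := ha.resolve_right fun h => hs'a (K.nx_unique h hs)
    have hm' : (K.S.filter fun v => K.B y v s).card ≤ m := by
      have : (K.S.filter fun v => K.B y v s) ⊂ (K.S.filter fun v => K.B y v s') := by
        rw [Finset.ssubset_iff_of_subset]
        · refine ⟨s, ?_, ?_⟩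
          · simp only [Finset.mem_filter]
            exact ⟨hs.1, (K.arc_right hs hy hys hys').2 (.inl rfl)⟩
          · simp only [Finset.mem_filter, not_and]
            exact fun _ h => (K.ne h).2.2 rfl
        · intro v
          simp only [Finset.mem_filter]
          exact fun h => ⟨h.1, (K.arc_right hs hy hys hys').2 (.inr h.2)⟩
      have := Finset.card_lt_card this
      omega
    rcases ih (A3 ++ [s']) D a s y st2.2.1 (by simp) ha' hm' (by omega) with
      hg | ⟨W, w, A2, h1, h2, h3⟩
    · left
      exact ((hg.step st2).step st1).mono (by omega)
    · right
      have hw : w ≠ s' := by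
        rintro rfl
        have h4 : K.B w y s :=
          (K.total hs.2.1 hy hs.1 hys'.symm hs.2.2.1.symm hys).resolve_right
            (fun h => hs.2.2.2 _ (K.rot h))
        have h5 : y ∈ a :: (A3 ++ [w]) := by rw [h1]; simp [(h2 y).1 h4]
        simp [hya, hyA, hys'] at h5
      have hA2 : A2 ≠ [] := by
        rintro rfl
        have := congrArg List.getLast? h1
        rw [← List.cons_append, List.getLast?_append, List.getLast?_append] at this
        simp at this
        exact hw this.symm
      obtain ⟨A2, z', rfl⟩ : ∃ A' z, A2 = A' ++ [z] :=
        ⟨_, _, (List.dropLast_append_getLast hA2).symm⟩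
      have h6 : (a :: A3) ++ [s'] = (W ++ w :: A2) ++ [z'] := by simpa using h1
      have h7 := List.append_inj_left' h6 rfl
      have hws : w ≠ s := by
        rintro rfl
        have : w ∈ a :: A3 := by rw [h7]; simp
        simp at this; tauto
      have hwS : w ∈ K.S := (hl.2.1 _).1 (by rw [h7]; simp)
      refine ⟨s :: W, w, A2, by rw [h7]; simp, fun v => ?_, by rw [← ho]; exact h3⟩
      rw [K.arc_right hs hwS hws hw, h2]
      simp

lemma idxOf_lt {l A D : List α} {a : α} (hl : l.Nodup) (h : l = A ++ a :: D) :
    (∀ x ∈ A, l.idxOf x < l.idxOf a) ∧ ∀ x ∈ D, l.idxOf a < l.idxOf x := by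
  subst h
  rw [List.nodup_append, List.nodup_cons] at hl
  have ha : a ∉ A := fun h => hl.2.2 a h a (by simp) rfl
  rw [List.idxOf_append_of_notMem ha, List.idxOf_cons_self]
  refine ⟨fun x hx => ?_, fun x hx => ?_⟩
  · rw [List.idxOf_append_of_mem hx]
    have := List.idxOf_lt_length_of_mem hx
    omega
  · have hxA : x ∉ A := fun h => hl.2.2 x h x (by simp [hx]) rfl
    rw [List.idxOf_append_of_notMem hxA, List.idxOf_cons_ne _ (by rintro rfl; tauto)]
    omega

lemma idxOf_succ {l A D : List α} {a b : α} (hl : l.Nodup) (h : l = A ++ a :: b :: D) :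
    l.idxOf b = l.idxOf a + 1 := by
  subst h
  rw [List.nodup_append, List.nodup_cons] at hl
  have ha : a ∉ A := fun h => hl.2.2 a h a (by simp) rfl
  have hb : b ∉ A := fun h => hl.2.2 b h b (by simp) rfl
  have hab : a ≠ b := by rintro rfl; simp at hl
  rw [List.idxOf_append_of_notMem ha, List.idxOf_cons_self, List.idxOf_append_of_notMem hb,
    List.idxOf_cons_ne _ hab, List.idxOf_cons_self]

/-- The obstruction to removing a chord from the path `l` by means of the cycle edge that joins
its first vertex to `s'`. -/
def Bad (l : List α) (s' : α) : Prop :=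
  ∃ W' w' M w W y D C C', l = W' ++ w' :: (M ++ w :: (W ++ s' :: y :: D)) ∧
    C ∈ K.chains ∧ C' ∈ K.chains ∧ w ∈ C ∧ y ∈ C ∧ w' ∈ C' ∧ y ∈ C' ∧ ¬ K.Outer s' y ∧
    K.B s' w y ∧ K.B y w' s' ∧ (∀ v, K.B s' v w ↔ v ∈ W) ∧ ∀ v, K.B w' v s' ↔ v ∈ W'

/-- Cutting the cyclic order open at the successor of `s`. -/
lemma exists_rank_nx {s s' : α} (h : K.Nx s s') : ∃ r : α → ℕ, r s' = 0 ∧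
    (∀ a ∈ K.S, a ≠ s' → 0 < r a) ∧ (∀ a ∈ K.S, a ≠ s → r a < r s) ∧
    (∀ a ∈ K.S, ∀ b ∈ K.S, a ≠ b → r a ≠ r b) ∧
    ∀ a ∈ K.S, ∀ b ∈ K.S, ∀ c ∈ K.S, (K.B a b c ↔ Cyc (r a) (r b) (r c)) := by
  obtain ⟨r, r0, rp, ri, hr⟩ := K.exists_rank h.2.1
  refine ⟨r, r0, rp, fun a ha hs => ?_, ri, hr⟩
  by_contra hn
  have h1 := ri a ha s h.1 hs
  have h2 := rp s h.1 h.2.2.1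
  apply h.2.2.2 a
  rw [hr s h.1 a ha s' h.2.1, r0]
  unfold Cyc
  omega

lemma gain_or_bad {A T : List α} {s s' : α} (hl : K.Good ((s :: A) ++ s' :: T)) (hA : A ≠ [])
    (hs : K.Nx s s') (hc : 0 < K.chd ((s :: A) ++ s' :: T)) :
    K.Gain (2 * K.S.card + 2) (K.chd ((s :: A) ++ s' :: T)) ((s :: A) ++ s' :: T) ∨
      K.Bad ((s :: A) ++ s' :: T) s' := by
  cases T with
  | nil =>
    left
    exact (K.gain_of_closed hl rfl (by rw [List.getLast?_append]; rfl) (.inr hs) hc).mono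
      (by omega)
  | cons y D =>
    rcases K.alpha K.S.card _ A D s s' y hl hA hs (Finset.card_filter_le _ _) le_rfl with
      h | ⟨A1, w, W, h1, h2, h3⟩
    · exact .inl h
    rcases K.gamma K.S.card _ A D s s' y hl hA hs (Finset.card_filter_le _ _) le_rfl with
      h | ⟨W', w', A2, h4, h5, h6⟩
    · exact .inl h
    right
    have hnd := hl.1
    have hmem : ∀ x, x ∈ s :: A ∨ x = s' ∨ x = y ∨ x ∈ D ↔ x ∈ K.S := by
      intro x; rw [← hl.2.1 x]; simp; tauto
    have hdis : ∀ x, x ∈ s :: A → x ≠ s' ∧ x ≠ y ∧ x ∉ D := by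
      intro x hx
      have := (List.nodup_append.1 hnd).2.2 x hx
      exact ⟨this s' (by simp), this y (by simp), fun h => this x (by simp [h]) rfl⟩
    have hys' : y ≠ s' := by
      have := (List.nodup_append.1 hnd).2.1; rintro rfl; simp at this
    have hy : y ∈ K.S := (hmem y).1 (by simp)
    have hwA : w ∈ s :: A := by simp [h1]
    have hwA' : w' ∈ s :: A := by simp [h4]
    have hw : w ∈ K.S := (hmem w).1 (.inl hwA)
    have hw' : w' ∈ K.S := (hmem w').1 (.inl hwA')
    have hsA : s ∉ A := by
      have := (List.nodup_append.1 hnd).1; simp at this; tauto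
    have hws : w ≠ s := by rintro rfl; apply hsA; simp [h1]
    have hAnd : (s :: A).Nodup := (List.nodup_append.1 hnd).1
    have hWA : ∀ v ∈ W, v ∈ s :: A := by intro v hv; simp [h1, hv]
    have hWA' : ∀ v ∈ W', v ∈ s :: A := by intro v hv; simp [h4, hv]
    have hWs : s ∉ W := fun h => hsA (by simp [h1, h])
    have a1 : ∀ v, K.B s' v w ↔ v ∈ W := by
      intro v
      have e := K.arc_left hs hw hws (hdis w hwA).1 (v := v)
      rw [h2] at e
      constructor
      · intro h
        rcases e.2 (.inr h) with rfl | h'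
        · exact ((K.ne h).1 rfl).elim
        · exact h'
      · intro h
        rcases e.1 (.inr h) with rfl | h'
        · exact ((hdis _ (hWA _ h)).1 rfl).elim
        · exact h'
    have b1 : K.B s' w y := by
      refine (K.total hs.2.1 hw hy (hdis w hwA).1.symm hys'.symm (hdis w hwA).2.1).resolve_right ?_
      exact fun h => (hdis _ (hWA _ ((a1 y).1 h))).2.1 rfl
    have b2 : K.B y w' s' := by
      refine (K.total hy hw' hs.2.1 (hdis w' hwA').2.1.symm hys' (hdis w' hwA').1).resolve_right ?_
      exact fun h => (hdis _ (hWA' _ ((h5 y).1 (K.rot' h)))).2.1 rfl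
    have hin : ¬ K.Outer s' y := by
      rintro ⟨C, hC, hs'C, hyC⟩
      refine K.contig C hC s' hs'C y hyC w hw w' hw' ?_ ?_ b1 b2
      · exact fun h => h3 ⟨fun _ => ⟨C, hC, hs'C, hyC⟩, fun _ => ⟨C, hC, h, hyC⟩⟩
      · exact fun h => h6 ⟨fun _ => ⟨C, hC, hs'C, hyC⟩, fun _ => ⟨C, hC, h, hyC⟩⟩
    obtain ⟨C, hC, hwC, hyC⟩ : K.Outer w y := by tauto
    obtain ⟨C', hC', hwC', hyC'⟩ : K.Outer w' y := by tauto
    have hww' : w ≠ w' := by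
      rintro rfl
      exact K.asymm b1 (K.rot' b2)
    have hwW' : w ∉ W' := by
      intro h
      have := (h5 w).2 h
      have h7 := K.rot b2
      exact K.asymm (K.trans b1 (K.rot' b2)) (K.rot' this)
    have hwA2 : w ∈ A2 := by
      rw [h4] at hwA
      simp only [List.mem_append, List.mem_cons] at hwA
      tauto
    obtain ⟨M, W2, rfl⟩ := List.append_of_mem hwA2
    have hW : W2 = W := by
      have e : (s :: A1) ++ w :: W = (W' ++ w' :: M) ++ w :: W2 := by
        rw [List.cons_append, ← h1, h4]; simp
      have e1 : w ∉ s :: A1 := by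
        intro h
        rw [h1, ← List.cons_append, List.nodup_append] at hAnd
        exact hAnd.2.2 w h w (by simp) rfl
      have e2 : w ∉ W' ++ w' :: M := by
        intro h
        rw [h4, show W' ++ w' :: (M ++ w :: W2) = (W' ++ w' :: M) ++ w :: W2 by simp,
          List.nodup_append] at hAnd
        exact hAnd.2.2 w h w (by simp) rfl
      rcases List.append_eq_append_iff.1 e with ⟨a, ha, hb⟩ | ⟨a, ha, hb⟩
      · cases a with
        | nil => simpa using hb.symm
        | cons b a =>
          simp only [List.cons_append, List.cons.injEq] at hb
          exact (e2 (by rw [ha]; simp [← hb.1])).elim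
      · cases a with
        | nil => simpa using hb
        | cons b a =>
          simp only [List.cons_append, List.cons.injEq] at hb
          exact (e1 (by rw [ha]; simp [← hb.1])).elim
    subst hW
    exact ⟨W', w', M, w, W2, y, D, C, C', by rw [h4]; simp, hC, hC', hwC, hyC, hwC', hyC', hin,
      b1, b2, a1, h5⟩

/-- A point strictly inside a chain lies on no other chain. -/
lemma chain_unique {C C₁ : Finset α} {w t w' z : α} (hC : C ∈ K.chains) (hw : w ∈ C)
    (ht : t ∈ C) (hw' : w' ∈ C) (hz : z ∉ C) (h : K.B w t w') (h' : K.B w' z w)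
    (hC₁ : C₁ ∈ K.chains) (ht' : t ∈ C₁) : C₁ = C := by
  by_contra hne
  obtain ⟨p, hp, q, hq, hpq, h1, h2⟩ := K.ends C hC
  have hS := K.mem h
  have hS' := K.mem h'
  have hpS := K.sub C hC hp
  have hqS := K.sub C hC hq
  obtain ⟨r, r0, rp, ri, hr⟩ := K.exists_rank hS.2.1
  rw [hr _ hS.1 _ hS.2.1 _ hS.2.2] at h
  rw [hr _ hS'.1 _ hS'.2.1 _ hS'.2.2] at h'
  have h3 := h1 t ht C₁ hC₁ hne ht'
  have h4 := h2 w hw z hS'.2.1 hz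
  have h5 := h2 w' hw' z hS'.2.1 hz
  rw [hr _ hpS _ hS.1 _ hqS, hr _ hpS _ hS'.2.1 _ hqS, hr _ hqS _ hS.1 _ hpS,
    hr _ hqS _ hS'.2.1 _ hpS] at h4
  rw [hr _ hpS _ hS.2.2 _ hqS, hr _ hpS _ hS'.2.1 _ hqS, hr _ hqS _ hS.2.2 _ hpS,
    hr _ hqS _ hS'.2.1 _ hpS] at h5
  have aux : ∀ (x : α) (P : Prop), (x ≠ p → x ≠ q → P) → r x = r p ∨ r x = r q ∨ P := by
    intro x P hP
    by_cases a1 : x = p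
    · exact .inl (a1 ▸ rfl)
    by_cases a2 : x = q
    · exact .inr (.inl (a2 ▸ rfl))
    exact .inr (.inr (hP a1 a2))
  have h6 := aux _ _ h4
  have h7 := aux _ _ h5
  have h8 : r t = r p ∨ r t = r q := h3.imp (congrArg r) (congrArg r)
  clear h4 h5
  unfold Cyc at *
  rcases h8 with h8 | h8 <;> rcases h6 with h6 | h6 | h6 | h6 <;> omega

/-- The positions on the path and on the cycle of the vertices of an obstructed path. -/
lemma bad_classes {l W' M W D : List α} {w' w s' y : α} {r : α → ℕ} (hl : K.Good l)
    (e : l = W' ++ w' :: (M ++ w :: (W ++ s' :: y :: D)))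
    (b1 : K.B s' w y) (b2 : K.B y w' s') (a1 : ∀ v, K.B s' v w ↔ v ∈ W)
    (a2 : ∀ v, K.B w' v s' ↔ v ∈ W') (r0 : r s' = 0) (rp : ∀ a ∈ K.S, a ≠ s' → 0 < r a)
    (ri : ∀ a ∈ K.S, ∀ b ∈ K.S, a ≠ b → r a ≠ r b)
    (hr : ∀ a ∈ K.S, ∀ b ∈ K.S, ∀ c ∈ K.S, (K.B a b c ↔ Cyc (r a) (r b) (r c))) :
    (0 < r w ∧ r w < r y ∧ r y < r w') ∧ l.idxOf w' < l.idxOf w ∧ l.idxOf w < l.idxOf s' ∧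
    l.idxOf y = l.idxOf s' + 1 ∧ ∀ x ∈ K.S,
      (x ∈ W' ∧ r w' < r x ∧ l.idxOf x < l.idxOf w') ∨
      (x = w' ∧ r x = r w' ∧ l.idxOf x = l.idxOf w') ∨
      (x ∈ M ∧ r w < r x ∧ r x < r w' ∧ l.idxOf w' < l.idxOf x ∧ l.idxOf x < l.idxOf w) ∨
      (x = w ∧ r x = r w ∧ l.idxOf x = l.idxOf w) ∨
      (x ∈ W ∧ 0 < r x ∧ r x < r w ∧ l.idxOf w < l.idxOf x ∧ l.idxOf x < l.idxOf s') ∨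
      (x = s' ∧ r x = 0 ∧ l.idxOf x = l.idxOf s') ∨
      (x = y ∧ r x = r y ∧ l.idxOf x = l.idxOf y) ∨
      (x ∈ D ∧ r w < r x ∧ r x < r w' ∧ l.idxOf y < l.idxOf x) := by
  have p1 := idxOf_lt hl.1 e
  have p2 := idxOf_lt hl.1 (show l = (W' ++ w' :: M) ++ w :: (W ++ s' :: y :: D) by simp [e])
  have p3 := idxOf_lt hl.1 (show l = (W' ++ w' :: M ++ w :: W) ++ s' :: y :: D by simp [e])
  have p4 := idxOf_succ hl.1 (show l = (W' ++ w' :: M ++ w :: W) ++ s' :: y :: D by simp [e])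
  have p5 := idxOf_lt hl.1 (show l = (W' ++ w' :: M ++ w :: W ++ [s']) ++ y :: D by simp [e])
  have q1 := p1.2 w (by simp)
  have q2 := p2.2 s' (by simp)
  have S1 := K.mem b1
  have S2 := K.mem b2
  have c1 := (hr _ S1.1 _ S1.2.1 _ S1.2.2).1 b1
  have c2 := (hr _ S2.1 _ S2.2.1 _ S2.2.2).1 b2
  have z1 := rp w S1.2.1 (K.ne b1).1.symm
  have z2 := rp y S2.1 (K.ne b2).2.1
  have z3 := rp w' S2.2.1 (K.ne b2).2.2
  rw [r0] at c1 c2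
  have c3 : 0 < r w ∧ r w < r y ∧ r y < r w' := by unfold Cyc at c1 c2; omega
  refine ⟨c3, q1, q2, p4, fun x hx => ?_⟩
  have u1 := hr s' S1.1 x hx w S1.2.1
  have u2 := hr w' S2.2.1 x hx s' S1.1
  rw [a1, r0] at u1
  rw [a2, r0] at u2
  have m : x ∈ W' ∨ x = w' ∨ x ∈ M ∨ x = w ∨ x ∈ W ∨ x = s' ∨ x = y ∨ x ∈ D := by
    have := (hl.2.1 x).2 hx
    rw [e] at this
    simp at this; tauto
  have i1 : x = w ∨ r x ≠ r w := or_iff_not_imp_left.2 fun h => ri x hx w S1.2.1 h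
  have i2 : x = w' ∨ r x ≠ r w' := or_iff_not_imp_left.2 fun h => ri x hx w' S2.2.1 h
  have i3 : x = s' ∨ 0 < r x := or_iff_not_imp_left.2 fun h => rp x hx h
  have mid : (¬ x ∈ W') → (¬ x ∈ W) → x ≠ w → x ≠ w' → x ≠ s' → r w < r x ∧ r x < r w' := by
    intro h1 h2 h3 h4 h5
    rw [u1] at h2
    rw [u2] at h1
    have := i1.resolve_left h3
    have := i2.resolve_left h4
    have := i3.resolve_left h5
    unfold Cyc at h1 h2
    omega
  rcases m with m | m | m | m | m | m | m | m
  · left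
    refine ⟨m, ?_, p1.1 x m⟩
    have := u2.1 m
    unfold Cyc at this; omega
  · subst m; simp
  · have h1 := p1.2 x (by simp [m])
    have h2 := p2.1 x (by simp [m])
    have h3 := mid (fun h => by have := p1.1 x h; omega)
      (fun h => by have := p2.2 x (by simp [h]); omega) (by rintro rfl; omega)
      (by rintro rfl; omega) (by rintro rfl; omega)
    exact .inr (.inr (.inl ⟨m, h3.1, h3.2, h1, h2⟩))
  · subst m; simp
  · have h1 := p2.2 x (by simp [m])
    have h2 := p3.1 x (by simp [m])
    have := u1.1 m
    unfold Cyc at this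
    exact .inr (.inr (.inr (.inr (.inl ⟨m, by omega, by omega, h1, h2⟩))))
  · subst m; simp [r0]
  · subst m; simp
  · have h1 := p5.2 x m
    have h3 := mid (fun h => by have := p1.1 x h; omega)
      (fun h => by have := p3.1 x (by simp [h]); omega) (by rintro rfl; omega)
      (by rintro rfl; omega) (by rintro rfl; omega)
    exact .inr (.inr (.inr (.inr (.inr (.inr (.inr ⟨m, h3.1, h3.2, h1⟩))))))

lemma not_bad_same {l W' M W D V' N U E : List α} {w' w s' y t' t v y₂ z : α} {C C₁ : Finset α}
    (hl : K.Good l) (e : l = W' ++ w' :: (M ++ w :: (W ++ s' :: y :: D)))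
    (e₂ : l.reverse = V' ++ t' :: (N ++ t :: (U ++ v :: y₂ :: E)))
    (hC : C ∈ K.chains) (hw : w ∈ C) (hy : y ∈ C) (hw' : w' ∈ C) (hin : ¬ K.Outer s' y)
    (b1 : K.B s' w y) (b2 : K.B y w' s') (a1 : ∀ v, K.B s' v w ↔ v ∈ W)
    (a2 : ∀ v, K.B w' v s' ↔ v ∈ W') (hC₁ : C₁ ∈ K.chains) (ht : t ∈ C₁) (hy₂ : y₂ ∈ C₁)
    (hin₂ : ¬ K.Outer v y₂) (hz : l.getLast? = some z)
    (hv : (K.Nx z v ∧ ∀ x, K.B v x t ↔ x ∈ U) ∨ (K.Nx v z ∧ ∀ x, K.B t x v ↔ x ∈ U)) :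
    False := by
  obtain ⟨r, r0, rp, ri, hr⟩ := K.exists_rank (K.mem b1).1
  obtain ⟨c1, q1, q2, q3, hcl⟩ := K.bad_classes hl e b1 b2 a1 a2 r0 rp ri hr
  have e₃ : l = E.reverse ++ y₂ :: v :: (U.reverse ++ t :: (N.reverse ++ t' :: V'.reverse)) := by
    rw [← List.reverse_reverse l, e₂]; simp
  have k1 := idxOf_succ hl.1 e₃
  have k2 := idxOf_lt hl.1 (show l = (E.reverse ++ [y₂]) ++ v :: (U.reverse ++ t ::
    (N.reverse ++ t' :: V'.reverse)) by simp [e₃])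
  have k3 := k2.2 t (by simp)
  have hs'C : s' ∉ C := fun h => hin ⟨C, hC, h, hy⟩
  have hsS := (K.mem b1).1
  have hwS := (K.mem b1).2.1
  have hw'S := (K.mem b2).2.1
  have hyS := (K.mem b2).1
  have hvS : v ∈ K.S := (hl.2.1 _).1 (by rw [e₃]; simp)
  have hy₂S : y₂ ∈ K.S := (hl.2.1 _).1 (by rw [e₃]; simp)
  have htS : t ∈ K.S := (hl.2.1 _).1 (by rw [e₃]; simp)
  have hall : ∀ x ∈ K.S, r w < r x → r x < r w' → x ∈ C := by
    intro x hx h1 h2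
    by_contra h
    refine K.contig C hC w' hw' w hw s' hsS x hx hs'C h ?_ ?_
    · rw [hr _ hw'S _ hsS _ hwS, r0]; unfold Cyc; omega
    · rw [hr _ hwS _ hx _ hw'S]; unfold Cyc; omega
  have hzS : z ∈ K.S := (hl.2.1 _).1 (List.mem_of_getLast? hz)
  have hzmax : ∀ x ∈ K.S, l.idxOf x ≤ l.idxOf z := by
    intro x hx
    obtain ⟨L, hL⟩ := List.getLast?_eq_some_iff.1 hz
    have h1 := idxOf_lt hl.1 (show l = L ++ z :: [] from hL)
    have h2 := (hl.2.1 x).2 hx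
    rw [hL] at h2
    simp only [List.mem_append, List.mem_singleton] at h2
    rcases h2 with h2 | rfl
    · exact (h1.1 x h2).le
    · rfl
  have z1 := hzmax y hyS
  have z2 : r w < r z ∧ r z < r w' := by
    have := hcl z hzS
    omega
  have hout : v ∈ C → y₂ ∈ C → False := fun h h' => hin₂ ⟨C, hC, h, h'⟩
  have h2 := hcl y₂ hy₂S
  have hnc : ¬ (r w ≤ r v ∧ r v ≤ r w') → False := by
    intro h
    rcases hv with ⟨hv, -⟩ | ⟨hv, -⟩
    · apply hv.2.2.2 w'
      rw [hr _ hzS _ hw'S _ hvS]; unfold Cyc; omega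
    · apply hv.2.2.2 w
      rw [hr _ hvS _ hwS _ hzS]; unfold Cyc; omega
  rcases hcl v hvS with h | ⟨rfl, -⟩ | h | ⟨rfl, -⟩ | h | h | ⟨rfl, -⟩ | h
  · exact hnc (by omega)
  · have h3 : y₂ ∈ W' ∧ r v < r y₂ := by
      rcases h2 with h2 | h2
      · exact ⟨h2.1, h2.2.1⟩
      · exfalso; omega
    have h4 : r t < r v := by
      have := hcl t htS
      omega
    rcases hv with ⟨hv, hU⟩ | ⟨hv, hU⟩
    · have h5 : y₂ ∈ U := by
        rw [← hU, hr _ hvS _ hy₂S _ htS]; unfold Cyc; omega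
      have := k2.2 y₂ (by simp [h5])
      omega
    · apply hv.2.2.2 y₂
      rw [hr _ hvS _ hy₂S _ hzS]; unfold Cyc; omega
  · refine hout (hall v hvS h.2.1 h.2.2.1) ?_
    rcases h2 with h2 | ⟨rfl, -⟩ | h2 | h2 | h2 | h2 | h2 | h2
    · omega
    · exact hw'
    · exact hall _ hy₂S h2.2.1 h2.2.2.1
    all_goals omega
  · refine hout hw ?_
    rcases h2 with h2 | ⟨rfl, -⟩ | h2 | h2 | h2 | h2 | h2 | h2
    · omega
    · exact hw'
    · exact hall _ hy₂S h2.2.1 h2.2.2.1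
    all_goals omega
  · exact hnc (by omega)
  · exact hnc (by omega)
  · have h3 : r w < r t ∧ r t < r w' := by
      have := hcl t htS
      omega
    have h4 : y₂ = s' := by
      rcases h2 with h2 | h2 | h2 | h2 | h2 | h2 | h2 | h2
      all_goals first | exact h2.1 | omega
    have h5 : C₁ = C := by
      refine K.chain_unique hC hw (hall t htS h3.1 h3.2) hw' hs'C ?_ ?_ hC₁ ht
      · rw [hr _ hwS _ htS _ hw'S]; unfold Cyc; omega
      · rw [hr _ hw'S _ hsS _ hwS, r0]; unfold Cyc; omega
    exact hs'C (h5 ▸ h4 ▸ hy₂)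
  · refine hout (hall v hvS h.2.1 h.2.2.1) ?_
    rcases h2 with h2 | h2 | h2 | h2 | h2 | h2 | ⟨rfl, -⟩ | h2
    · omega
    · omega
    · omega
    · omega
    · omega
    · omega
    · exact hy
    · exact hall _ hy₂S h2.2.1 h2.2.2.1

lemma exists_switch (P : α → Prop) (M : List α) (w : α) (hw : ¬ P w) : ∀ w', P w' →
    ∃ L a b R, w' :: (M ++ [w]) = L ++ a :: b :: R ∧ P a ∧ ¬ P b := by
  induction M with
  | nil => exact fun w' h => ⟨[], w', w, [], rfl, h, hw⟩
  | cons m M ih =>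
    intro w' h
    by_cases hm : P m
    · obtain ⟨L, a, b, R, h1, h2⟩ := ih m hm
      exact ⟨w' :: L, a, b, R, by simp at h1 ⊢; exact h1, h2⟩
    · exact ⟨[], w', m, M ++ [w], rfl, h, hm⟩

lemma ed_mid {A D : List α} {a b : α} : Ed (A ++ a :: b :: D) a b := by
  rw [ed_append]; right; left; left; simp

lemma bad_distinct {l W' M W D : List α} {w' w s' y : α} {C C' : Finset α}
    (hl : K.Good l) (e : l = W' ++ w' :: (M ++ w :: (W ++ s' :: y :: D)))
    (hC : C ∈ K.chains) (hw : w ∈ C) (hy : y ∈ C) (hC' : C' ∈ K.chains) (hw' : w' ∈ C')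
    (hy' : y ∈ C') (hne : C ≠ C') (hin : ¬ K.Outer s' y)
    (b1 : K.B s' w y) (b2 : K.B y w' s') (a1 : ∀ v, K.B s' v w ↔ v ∈ W)
    (a2 : ∀ v, K.B w' v s' ↔ v ∈ W') :
    M = [] ∧ ∃ C₂ ∈ K.chains, w ∈ C₂ ∧ w' ∈ C₂ ∧ y ∉ C₂ ∧ C₂ ≠ C ∧ C₂ ≠ C' := by
  obtain ⟨r, r0, rp, ri, hr⟩ := K.exists_rank (K.mem b1).1
  obtain ⟨c1, q1, q2, q3, hcl⟩ := K.bad_classes hl e b1 b2 a1 a2 r0 rp ri hr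
  have hs'C : s' ∉ C := fun h => hin ⟨C, hC, h, hy⟩
  have hs'C' : s' ∉ C' := fun h => hin ⟨C', hC', h, hy'⟩
  have hsS := (K.mem b1).1
  have hwS := (K.mem b1).2.1
  have hw'S := (K.mem b2).2.1
  have hyS := (K.mem b2).1
  obtain ⟨L, a, b, R, h1, h2, h3⟩ := exists_switch (fun x => r y < r x) M w (by omega) w' c1.2.2
  have e₁ : l = (W' ++ L) ++ a :: b :: (R ++ W ++ s' :: y :: D) := by
    rw [e, show W' ++ w' :: (M ++ w :: (W ++ s' :: y :: D)) =
      W' ++ (w' :: (M ++ [w])) ++ (W ++ s' :: y :: D) by simp, h1]; simp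
  have e₂ : l = (W' ++ w' :: M ++ w :: W) ++ s' :: y :: D := by rw [e]; simp
  have haS : a ∈ K.S := (hl.2.1 _).1 (by rw [e₁]; simp)
  have hbS : b ∈ K.S := (hl.2.1 _).1 (by rw [e₁]; simp)
  have hab : (∀ x, x = a ∨ x = b → x ∈ w' :: (M ++ [w])) := by
    rw [h1]; rintro x (rfl | rfl) <;> simp
  have hMp : ∀ x ∈ w' :: (M ++ [w]), l.idxOf w' ≤ l.idxOf x ∧ l.idxOf x ≤ l.idxOf w := by
    have p1 := idxOf_lt hl.1 e
    have p2 := idxOf_lt hl.1 (show l = (W' ++ w' :: M) ++ w :: (W ++ s' :: y :: D) by simp [e])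
    intro x hx
    simp only [List.mem_cons, List.mem_append, List.not_mem_nil, or_false] at hx
    rcases hx with rfl | hx | rfl
    · omega
    · exact ⟨(p1.2 x (by simp [hx])).le, (p2.1 x (by simp [hx])).le⟩
    · omega
  have pa := hMp a (hab a (.inl rfl))
  have pb := hMp b (hab b (.inr rfl))
  have pab := idxOf_succ hl.1 e₁
  have hrb : r b ≠ r y := by
    intro h
    by_cases hby : b = y
    · rw [hby] at pb; omega
    · exact ri b hbS y hyS hby h
  have ra := hcl a haS
  have rb := hcl b hbS
  have hX := hl.2.2 a b s' y (by rw [e₁]; exact ed_mid) (by rw [e₂]; exact ed_mid)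
  have hAlt : K.Alt a b s' y := by
    left
    rw [hr _ haS _ hsS _ hbS, hr _ hbS _ hyS _ haS, r0]
    unfold Cyc; omega
  obtain ⟨C₂, hC₂, haC₂, hbC₂⟩ : K.Outer a b := by
    by_contra h
    exact hX ⟨hAlt, fun h' => (h h').elim, fun h' => (hin h').elim⟩
  have haC' : a ∈ C' := by
    by_contra h
    refine K.contig C' hC' y hy' w' hw' a haS s' hsS h hs'C' ?_ ?_
    · rw [hr _ hyS _ haS _ hw'S]
      have : a ≠ w' := by rintro rfl; exact h hw'
      have := ri a haS w' hw'S this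
      unfold Cyc; omega
    · rw [hr _ hw'S _ hsS _ hyS, r0]; unfold Cyc; omega
  have hbC : b ∈ C := by
    by_contra h
    refine K.contig C hC w hw y hy b hbS s' hsS h hs'C ?_ ?_
    · rw [hr _ hwS _ hbS _ hyS]
      have : b ≠ w := by rintro rfl; exact h hw
      have := ri b hbS w hwS this
      unfold Cyc; omega
    · rw [hr _ hyS _ hsS _ hwS, r0]; unfold Cyc; omega
  have hne₁ : C₂ ≠ C := by
    rintro rfl
    have := K.inter C₂ hC C' hC' hne a haC₂ haC' y hy hy'
    subst this; omega
  have hne₂ : C₂ ≠ C' := by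
    rintro rfl
    have := K.inter C hC C₂ hC' hne b hbC hbC₂ y hy hy'
    subst this; omega
  have ea : a = w' := by
    by_contra h
    have := ri a haS w' hw'S h
    refine hne₂ (K.chain_unique hC' hy' haC' hw' hs'C' ?_ ?_ hC₂ haC₂)
    · rw [hr _ hyS _ haS _ hw'S]; unfold Cyc; omega
    · rw [hr _ hw'S _ hsS _ hyS, r0]; unfold Cyc; omega
  have eb : b = w := by
    by_contra h
    have := ri b hbS w hwS h
    refine hne₁ (K.chain_unique hC hw hbC hy hs'C ?_ ?_ hC₂ hbC₂)
    · rw [hr _ hwS _ hbS _ hyS]; unfold Cyc; omega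
    · rw [hr _ hyS _ hsS _ hwS, r0]; unfold Cyc; omega
  subst ea eb
  refine ⟨?_, C₂, hC₂, hbC₂, haC₂, fun h => ?_, hne₁, hne₂⟩
  · cases M with
    | nil => rfl
    | cons m M =>
      exfalso
      have p1 := (idxOf_lt hl.1 e).2 m (by simp)
      have p2 := (idxOf_lt hl.1 (show l = (W' ++ a :: m :: M) ++ b :: (W ++ s' :: y :: D) by
        simp [e])).1 m (by simp)
      omega
  · exact (K.two C hC C' hC' C₂ hC₂ hne y hy hy' h).elim hne₁ hne₂

lemma not_bad_distinct {l l' W' W D V' N U E : List α} {w' w s' y t' t v y₂ : α}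
    {C C' C₂ C₃ : Finset α} (hl : K.Good l) (hl' : K.Good l')
    (e : l = W' ++ w' :: ([] ++ w :: (W ++ s' :: y :: D)))
    (e' : l' = w' :: W'.reverse ++ w :: (W ++ s' :: y :: D))
    (hC : C ∈ K.chains) (hw : w ∈ C) (hy : y ∈ C) (hC' : C' ∈ K.chains) (hw' : w' ∈ C')
    (hy' : y ∈ C') (hne : C ≠ C') (hin : ¬ K.Outer s' y)
    (b1 : K.B s' w y) (b2 : K.B y w' s') (a1 : ∀ v, K.B s' v w ↔ v ∈ W)
    (a2 : ∀ v, K.B w' v s' ↔ v ∈ W') (hC₂ : C₂ ∈ K.chains) (hw₂ : w ∈ C₂) (hw'₂ : w' ∈ C₂)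
    (hy₂ : y ∉ C₂) (hne₂ : C₂ ≠ C) (hv : K.Nx v w')
    (e₂ : l' = V' ++ t' :: (N ++ t :: (U ++ v :: y₂ :: E)))
    (hC₃ : C₃ ∈ K.chains) (ht' : t' ∈ C₃) (hy₃ : y₂ ∈ C₃) (hin₂ : ¬ K.Outer v y₂)
    (b3 : K.B v t' y₂) (a3 : ∀ x, K.B v x t' ↔ x ∈ V') : False := by
  obtain ⟨r, r0, rp, ri, hr⟩ := K.exists_rank (K.mem b1).1
  obtain ⟨c1, q1, q2, q3, hcl⟩ := K.bad_classes hl e b1 b2 a1 a2 r0 rp ri hr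
  have hs'C : s' ∉ C := fun h => hin ⟨C, hC, h, hy⟩
  have hs'C' : s' ∉ C' := fun h => hin ⟨C', hC', h, hy'⟩
  have hsS := (K.mem b1).1
  have hwS := (K.mem b1).2.1
  have hw'S := (K.mem b2).2.1
  have hyS := (K.mem b2).1
  have hvS := hv.1
  have hv1 : v = y ∨ r y < r v := by
    by_contra h
    push Not at h
    have h1 := ri v hvS y hyS h.1
    apply hv.2.2.2 y
    rw [hr _ hvS _ hyS _ hw'S]; unfold Cyc; omega
  have hv2 : r v < r w' := by
    have h1 := ri v hvS w' hw'S hv.2.2.1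
    by_contra h
    apply hv.2.2.2 y
    rw [hr _ hvS _ hyS _ hw'S]; unfold Cyc; omega
  have hv3 : r y ≤ r v := by
    rcases hv1 with h | h
    · rw [h]
    · exact h.le
  have p1 := idxOf_lt hl'.1 e'
  have p2 := idxOf_lt hl'.1 (show l' = (w' :: W'.reverse ++ w :: W) ++ s' :: y :: D by simp [e'])
  have p3 := idxOf_lt hl'.1
    (show l' = (w' :: W'.reverse ++ w :: W ++ [s']) ++ y :: D by simp [e'])
  have p4 := idxOf_succ hl'.1
    (show l' = (V' ++ t' :: (N ++ t :: U)) ++ v :: y₂ :: E by simp [e₂])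
  have p5 := idxOf_lt hl'.1 e₂
  have p6 := p1.2 s' (by simp)
  have p7 := p2.2 y (by simp)
  have hy₂S : y₂ ∈ K.S := (hl'.2.1 _).1 (by rw [e₂]; simp)
  have ht'S := (K.mem b3).2.1
  have hvp : l'.idxOf y ≤ l'.idxOf v := by
    rcases hcl v hvS with h | h | h | h | h | h | h | h
    · omega
    · omega
    · simp at h
    · omega
    · omega
    · omega
    · rw [h.1]
    · exact (p3.2 v h.1).le
  have hy₂D : r w < r y₂ ∧ r y₂ < r w' ∧ y₂ ≠ y := by
    have hn : y₂ ≠ y := by rintro rfl; omega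
    rcases hcl y₂ hy₂S with h | h | h | h | h | h | h | h
    · have := p1.1 y₂ (by simp [h.1])
      omega
    · have := p1.1 y₂ (by simp [h.1])
      omega
    · simp at h
    · rw [h.1] at p4; omega
    · have := p2.1 y₂ (by simp [h.1])
      omega
    · rw [h.1] at p4; omega
    · exact (hn h.1).elim
    · exact ⟨h.2.1, h.2.2.1, hn⟩
  have hallC' : ∀ x ∈ K.S, r y < r x → r x < r w' → x ∈ C' := by
    intro x hx h1 h2
    by_contra h
    refine K.contig C' hC' y hy' w' hw' x hx s' hsS h hs'C' ?_ ?_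
    · rw [hr _ hyS _ hx _ hw'S]; unfold Cyc; omega
    · rw [hr _ hw'S _ hsS _ hyS, r0]; unfold Cyc; omega
  have hallC : ∀ x ∈ K.S, r w < r x → r x < r y → x ∈ C := by
    intro x hx h1 h2
    by_contra h
    refine K.contig C hC w hw y hy x hx s' hsS h hs'C ?_ ?_
    · rw [hr _ hwS _ hx _ hyS]; unfold Cyc; omega
    · rw [hr _ hyS _ hsS _ hwS, r0]; unfold Cyc; omega
  have hallC₂ : ∀ x ∈ K.S, r x < r w ∨ r w' < r x → x ∈ C₂ := by
    intro x hx h1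
    by_contra h
    refine K.contig C₂ hC₂ w' hw'₂ w hw₂ x hx y hyS h hy₂ ?_ ?_
    · rw [hr _ hw'S _ hx _ hwS]; unfold Cyc; omega
    · rw [hr _ hwS _ hyS _ hw'S]; unfold Cyc; omega
  have hvC' : v ∈ C' := hv1.elim (fun h => h ▸ hy') fun h => hallC' v hvS h hv2
  have hy₂C' : y₂ ∉ C' := fun h => hin₂ ⟨C', hC', hvC', h⟩
  have hy₂r : r y₂ < r y := by
    have := ri y₂ hy₂S y hyS hy₂D.2.2
    by_contra h
    exact hy₂C' (hallC' y₂ hy₂S (by omega) hy₂D.2.1)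
  have hy₂C := hallC y₂ hy₂S hy₂D.1 hy₂r
  have hC₃C : C₃ = C := by
    refine K.chain_unique hC hw hy₂C hy hs'C ?_ ?_ hC₃ hy₃
    · rw [hr _ hwS _ hy₂S _ hyS]; unfold Cyc; omega
    · rw [hr _ hyS _ hsS _ hwS, r0]; unfold Cyc; omega
  subst hC₃C
  have hv4 : r y < r v := hv1.resolve_left fun h => hin₂ ⟨C₃, hC, h ▸ hy, hy₂C⟩
  rw [hr _ hvS _ ht'S _ hy₂S] at b3
  rcases hcl t' ht'S with h | h | h | h | h | h | h | h
  · have h1 := K.inter C₃ hC C₂ hC₂ hne₂.symm t' ht' (hallC₂ _ ht'S (.inr h.2.1)) w hw hw₂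
    rw [h1] at h; omega
  · have h1 := K.inter C₃ hC C' hC' hne t' ht' (h.1 ▸ hw') y hy hy'
    rw [h1] at h; omega
  · simp at h
  · have h1 : s' ∈ V' := by
      rw [← a3, hr _ hvS _ hsS _ ht'S]; unfold Cyc; omega
    have := p5.1 s' h1
    rw [h.1] at this
    omega
  · have h1 := K.inter C₃ hC C₂ hC₂ hne₂.symm t' ht' (hallC₂ _ ht'S (.inl h.2.2.1)) w hw hw₂
    rw [h1] at h; omega
  · exact hs'C (h.1 ▸ ht')
  · unfold Cyc at b3; omega
  · have h1 := p3.2 t' h.1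
    have h2 : y ∈ V' := by
      have h3 := (hl'.2.1 y).2 hyS
      rw [e₂] at h3
      simp only [List.mem_append, List.mem_cons] at h3
      rcases h3 with h3 | h3 | h3
      · exact h3
      · rw [h3] at h1; omega
      · have := p5.2 y (by simpa using h3)
        omega
    rw [← a3, hr _ hvS _ hyS _ ht'S] at h2
    unfold Cyc at b3 h2
    omega

lemma gain_of_bad_distinct {l W' W D : List α} {w' w s s' y : α}
    {C C' C₂ : Finset α} (hl : K.Good l) (hs : K.Nx s s') (hls : l.head? = some s)
    (e : l = W' ++ w' :: ([] ++ w :: (W ++ s' :: y :: D)))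
    (hC : C ∈ K.chains) (hw : w ∈ C) (hy : y ∈ C) (hC' : C' ∈ K.chains) (hw' : w' ∈ C')
    (hy' : y ∈ C') (hne : C ≠ C') (hin : ¬ K.Outer s' y)
    (b1 : K.B s' w y) (b2 : K.B y w' s') (a1 : ∀ v, K.B s' v w ↔ v ∈ W)
    (a2 : ∀ v, K.B w' v s' ↔ v ∈ W') (hC₂ : C₂ ∈ K.chains) (hw₂ : w ∈ C₂) (hw'₂ : w' ∈ C₂)
    (hy₂ : y ∉ C₂) (hne₂ : C₂ ≠ C) (hc : 0 < K.chd l) :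
    K.Gain (2 * K.S.card + 3) (K.chd l) l := by
  obtain ⟨r, r0, rp, rs, ri, hr⟩ := K.exists_rank_nx hs
  obtain ⟨c1, q1, q2, q3, hcl⟩ := K.bad_classes hl e b1 b2 a1 a2 r0 rp ri hr
  have hsS := hs.1
  have hs'S := hs.2.1
  have hwS := (K.mem b1).2.1
  have hw'S := (K.mem b2).2.1
  have hyS := (K.mem b2).1
  have e₁ : l = (W' ++ [w']) ++ w :: (W ++ s' :: y :: D) := by rw [e]; simp
  have hsW : s ∈ W' ++ [w'] := by
    rw [e₁, List.head?_append_of_ne_nil _ (by simp)] at hls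
    exact List.mem_of_mem_head? hls
  have hsp : l.idxOf s < l.idxOf w := (idxOf_lt hl.1 e₁).1 s hsW
  have hrs : r w' ≤ r s := by
    rcases hcl s hsS with h | h | h | h | h | h | h | h
    · omega
    · omega
    · simp at h
    all_goals omega
  have hws : w ≠ s := by rintro rfl; omega
  have hrw := rs w hwS hws
  have hsC₂ : s ∈ C₂ := by
    by_cases h : s = w'
    · exact h ▸ hw'₂
    have := ri s hsS w' hw'S h
    by_contra h
    refine K.contig C₂ hC₂ w' hw'₂ w hw₂ s hsS y hyS h hy₂ ?_ ?_
    · rw [hr _ hw'S _ hsS _ hwS]; unfold Cyc; omega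
    · rw [hr _ hwS _ hyS _ hw'S]; unfold Cyc; omega
  have hout : K.Outer s w := ⟨C₂, hC₂, hsC₂, hw₂⟩
  have hX : ∀ c d, (r c ≤ r w ∧ r d ≤ r w ∨ r w < r c ∧ r w < r d) → ¬ K.X s w c d := by
    rintro c d hcd ⟨hA, -⟩
    obtain ⟨-, -, hcS, hdS⟩ := K.alt_mem hA
    unfold Alt at hA
    have i1 : c = s ∨ r c < r s := or_iff_not_imp_left.2 fun h => rs c hcS h
    have i2 : d = s ∨ r d < r s := or_iff_not_imp_left.2 fun h => rs d hdS h
    have j1 : r c ≤ r s := by rcases i1 with rfl | h <;> omega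
    have j2 : r d ≤ r s := by rcases i2 with rfl | h <;> omega
    rw [hr _ hsS _ hcS _ hwS, hr _ hwS _ hdS _ hsS, hr _ hsS _ hdS _ hwS,
      hr _ hwS _ hcS _ hsS] at hA
    unfold Cyc at hA
    omega
  have st : K.Step l ((W' ++ [w']).reverse ++ w :: (W ++ s' :: y :: D)) := by
    rw [e₁] at hl hls hcl q1 q2 q3 ⊢
    rw [List.head?_append_of_ne_nil _ (by simp)] at hls
    refine K.step_reverse hl hls rfl ?_
    have hW' : ∀ x ∈ W' ++ [w'], r w < r x := by
      intro x hx
      rw [List.mem_append, List.mem_singleton] at hx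
      rcases hx with hx | rfl
      · have h1 := (a2 x).2 hx
        rw [hr _ hw'S _ (K.mem h1).2.1 _ hs'S, r0] at h1
        unfold Cyc at h1; omega
      · omega
    have hW : ∀ x ∈ w :: (W ++ [s']), r x ≤ r w := by
      intro x hx
      simp only [List.mem_append, List.mem_cons, List.not_mem_nil, or_false] at hx
      rcases hx with rfl | hx | rfl
      · omega
      · have h1 := (a1 x).2 hx
        rw [hr _ hs'S _ (K.mem h1).2.1 _ hwS, r0] at h1
        unfold Cyc at h1; omega
      · omega
    have hD : ∀ x ∈ y :: D, r w < r x := by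
      intro x hx
      have hxS := (hl.2.1 x).1 (by simp at hx ⊢; tauto)
      have hp := idxOf_lt hl.1 (show (W' ++ [w']) ++ w :: (W ++ s' :: y :: D) =
        (W' ++ [w'] ++ w :: W) ++ s' :: y :: D by simp)
      have := hp.2 x hx
      rcases hcl x hxS with h | h | h | h | h | h | h | h
      · omega
      · omega
      · simp at h
      all_goals omega
    rintro c d (h | h)
    · have := ed_mem h
      exact hX c d (.inr ⟨hW' c this.1, hW' d this.2⟩)
    · rw [show w :: (W ++ s' :: y :: D) = (w :: (W ++ [s'])) ++ y :: D by simp, ed_append] at h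
      rcases h with h | h | ⟨a, b, h1, h2, h3⟩
      · have := ed_mem h
        exact hX c d (.inl ⟨hW c this.1, hW d this.2⟩)
      · have := ed_mem h
        exact hX c d (.inr ⟨hD c this.1, hD d this.2⟩)
      · rw [← List.cons_append, List.getLast?_append] at h1
        cases h1; cases h2
        have hn : ¬ K.X s w s' y := fun h => hin (h.2.1 hout)
        rcases h3 with ⟨rfl, rfl⟩ | ⟨rfl, rfl⟩
        · exact hn
        · exact fun h => hn (K.x_comm_right.1 h)
  by_cases hlt : K.chd ((W' ++ [w']).reverse ++ w :: (W ++ s' :: y :: D)) < K.chd l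
  · exact (gain_of_step st hlt).mono (by omega)
  have hle : K.chd ((W' ++ [w']).reverse ++ w :: (W ++ s' :: y :: D)) = K.chd l := by
    refine le_antisymm ?_ (by omega)
    rw [e₁, chd_append, chd_append _ (W' ++ [w']), chd_reverse, List.getLast?_append]
    have hch : ¬ K.Nbr w' w := by
      rintro (h | h)
      · apply h.2.2.2 s'
        rw [hr _ hw'S _ hs'S _ hwS, r0]; unfold Cyc; omega
      · apply h.2.2.2 y
        rw [hr _ hwS _ hyS _ hw'S]; unfold Cyc; omega
    rw [e₁, List.head?_append_of_ne_nil _ (by simp)] at hls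
    rw [List.getLast?_reverse, hls]
    have : K.wt s w ≤ 1 := by unfold wt; split_ifs <;> simp
    simp only [lnk, List.getLast?_singleton, Option.some_or, List.head?_cons, K.wt_chord hch]
    omega
  obtain ⟨v, hv⟩ := K.rev.exists_nx (a := w') (b := w) hw'S hwS (by rintro rfl; omega)
  have hv' := K.nx_rev.1 hv
  have hvS := hv'.1
  have hvr : r w < r v ∧ r v < r w' := by
    have i1 := ri v hvS w' hw'S hv'.2.2.1
    have := hv'.2.2.2 y
    rw [hr _ hvS _ hyS _ hw'S] at this
    unfold Cyc at this; omega
  have hvD : v ∈ y :: D := by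
    rcases hcl v hvS with h | h | h | h | h | h | h | h
    · omega
    · omega
    · simp at h
    · omega
    · omega
    · omega
    · simp [h.1]
    · simp [h.1]
  obtain ⟨D₁, D₂, hD⟩ := List.append_of_mem hvD
  have e₃ : (W' ++ [w']).reverse ++ w :: (W ++ s' :: y :: D) =
      (w' :: (W'.reverse ++ w :: (W ++ s' :: D₁))) ++ v :: D₂ := by rw [hD]; simp
  have hl' := st.2.1
  rw [e₃] at hle hl'
  rcases K.rev.gain_or_bad (K.good_rev.2 hl') (by simp) hv (by rw [chd_rev]; omega) with h | h
  · rw [chd_rev, hle, ← e₃] at h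
    exact (gain_rev h).step st
  · exfalso
    rw [← e₃] at h hl'
    obtain ⟨V', t', N, t, U, y₂, E, C₄, C₃, e₂, hC₄, hC₃, ht, hy₄, ht', hy₃, hin₂, b4, b3, a4, a3⟩ := h
    exact K.not_bad_distinct hl hl' e (by simp) hC hw hy hC' hw' hy' hne hin b1 b2 a1 a2 hC₂ hw₂
      hw'₂ hy₂ hne₂ hv' e₂ hC₃ ht' hy₃ hin₂ b3 a3

lemma not_nx_nx {a b d : α} (h : K.Nx a b) (h' : K.Nx b a) (hd : d ∈ K.S) (hda : d ≠ a)
    (hdb : d ≠ b) : False := by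
  rcases K.total h.1 h.2.1 hd h.2.2.1 hda.symm hdb.symm with h1 | h1
  · exact h'.2.2.2 _ (K.rot h1)
  · exact h.2.2.2 _ h1

/-- The first vertex of a path has a neighbor on the cycle other than the second vertex. -/
lemma exists_nbr {l : List α} (hl : K.Good l) (hn : 3 ≤ l.length) :
    ∃ s s' A T, l = (s :: A) ++ s' :: T ∧ A ≠ [] ∧ (K.Nx s s' ∨ K.Nx s' s) := by
  obtain ⟨s, b, d, t, rfl⟩ : ∃ s b d t, l = s :: b :: d :: t := by
    rcases l with _ | ⟨s, _ | ⟨b, _ | ⟨d, t⟩⟩⟩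
    · simp at hn
    · simp at hn
    · simp at hn
    · exact ⟨s, b, d, t, rfl⟩
  have hs : s ∈ K.S := (hl.2.1 s).1 (by simp)
  have hb : b ∈ K.S := (hl.2.1 b).1 (by simp)
  have hd : d ∈ K.S := (hl.2.1 d).1 (by simp)
  have hnd := hl.1
  simp only [List.nodup_cons, List.mem_cons, not_or] at hnd
  obtain ⟨⟨h1, h2, -⟩, ⟨h3, -⟩, -⟩ := hnd
  have key : ∀ c, K.Nx s c ∨ K.Nx c s → c ≠ b →
      ∃ s₀ s' A T, s :: b :: d :: t = (s₀ :: A) ++ s' :: T ∧ A ≠ [] ∧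
        (K.Nx s₀ s' ∨ K.Nx s' s₀) := by
    intro c hc hcb
    have hcs : c ≠ s := by
      rcases hc with hc | hc
      · exact hc.2.2.1.symm
      · exact hc.2.2.1
    have hcl := (hl.2.1 c).2 (by rcases hc with hc | hc; exacts [hc.2.1, hc.1])
    simp only [List.mem_cons, hcs, hcb, false_or] at hcl
    obtain ⟨T₁, T₂, hT⟩ := List.append_of_mem (List.mem_cons.2 hcl)
    exact ⟨s, c, b :: T₁, T₂, by simp [hT], by simp, hc⟩
  by_cases h : K.Nx s b
  · obtain ⟨c, hc⟩ := K.rev.exists_nx hs hb h1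
    rw [nx_rev] at hc
    refine key c (.inr hc) ?_
    rintro rfl
    exact K.not_nx_nx h hc hd (Ne.symm h2) (Ne.symm h3)
  · obtain ⟨c, hc⟩ := K.exists_nx hs hb h1
    exact key c (.inl hc) fun hcb => h (hcb ▸ hc)

lemma length_of_good {l : List α} (hl : K.Good l) : l.length = K.S.card := by
  rw [← List.toFinset_card_of_nodup hl.1]
  congr 1
  ext x
  rw [List.mem_toFinset, hl.2.1]

lemma gain_of_bad_same {l W' M W D : List α} {w' w s' y : α}
    {C : Finset α} (hl : K.Good l)
    (e : l = W' ++ w' :: (M ++ w :: (W ++ s' :: y :: D)))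
    (hC : C ∈ K.chains) (hw : w ∈ C) (hy : y ∈ C) (hw' : w' ∈ C) (hin : ¬ K.Outer s' y)
    (b1 : K.B s' w y) (b2 : K.B y w' s') (a1 : ∀ v, K.B s' v w ↔ v ∈ W)
    (a2 : ∀ v, K.B w' v s' ↔ v ∈ W') (hc : 0 < K.chd l) :
    K.Gain (2 * K.S.card + 3) (K.chd l) l := by
  have h3 : 3 ≤ l.reverse.length := by simp [e]; omega
  have hlr : K.Good l.reverse := Good.reverse K hl
  obtain ⟨z, v, A, T, e₁, hA, hv⟩ := K.exists_nbr hlr h3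
  have hz : l.getLast? = some z := by
    rw [← List.head?_reverse, e₁]; rfl
  refine Gain.step (K.step_reverse_all hl) ?_
  rw [← K.chd_reverse l] at hc ⊢
  rcases hv with hv | hv
  · rw [e₁] at hlr hc
    have := K.gain_or_bad hlr hA hv hc
    rw [← e₁] at this
    refine this.resolve_right ?_
    rintro ⟨V', t', N, t, U, y₂, E, C₁, C₁', e₂, hC₁, -, ht, hy₂, -, -, hin₂, -, -, a3, -⟩
    exact K.not_bad_same hl e e₂ hC hw hy hw' hin b1 b2 a1 a2 hC₁ ht hy₂ hin₂ hz (.inl ⟨hv, a3⟩)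
  · rw [e₁] at hlr hc
    have := K.rev.gain_or_bad (K.good_rev.2 hlr) hA (K.nx_rev.2 hv) (by rwa [chd_rev])
    rw [← e₁, chd_rev] at this
    refine gain_rev (this.resolve_right ?_)
    rintro ⟨V', t', N, t, U, y₂, E, C₁, C₁', e₂, hC₁, -, ht, hy₂, -, -, hin₂, -, -, a3, -⟩
    exact K.not_bad_same hl e e₂ hC hw hy hw' hin b1 b2 a1 a2 hC₁ ht hy₂ hin₂ hz (.inr ⟨hv, a3⟩)

lemma gain_of_nx {A T : List α} {s s' : α} (hl : K.Good ((s :: A) ++ s' :: T)) (hA : A ≠ [])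
    (hs : K.Nx s s') (hc : 0 < K.chd ((s :: A) ++ s' :: T)) :
    K.Gain (2 * K.S.card + 3) (K.chd ((s :: A) ++ s' :: T)) ((s :: A) ++ s' :: T) := by
  rcases K.gain_or_bad hl hA hs hc with h | h
  · exact h.mono (by omega)
  have hls : ((s :: A) ++ s' :: T).head? = some s := rfl
  obtain ⟨W', w', M, w, W, y, D, C, C', e, hC, hC', hw, hy, hw', hy', hin, b1, b2, a1, a2⟩ := h
  by_cases hne : C = C'
  · subst hne
    exact K.gain_of_bad_same hl e hC hw hy hw' hin b1 b2 a1 a2 hc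
  · obtain ⟨rfl, C₂, hC₂, hw₂, hw'₂, hy₂, hne₂, -⟩ :=
      K.bad_distinct hl e hC hw hy hC' hw' hy' hne hin b1 b2 a1 a2
    exact K.gain_of_bad_distinct hl hs hls e hC hw hy hC' hw' hy' hne hin b1 b2 a1 a2 hC₂ hw₂ hw'₂
      hy₂ hne₂ hc

lemma gain_of_chd_pos {l : List α} (hl : K.Good l) (hc : 0 < K.chd l) (hn : 3 ≤ l.length) :
    K.Gain (2 * K.S.card + 3) (K.chd l) l := by
  obtain ⟨s, s', A, T, rfl, hA, hs | hs⟩ := K.exists_nbr hl hn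
  · exact K.gain_of_nx hl hA hs hc
  · have := K.rev.gain_of_nx (K.good_rev.2 hl) hA (K.nx_rev.2 hs) (by rwa [chd_rev])
    rw [chd_rev] at this
    exact gain_rev this

lemma chd_le (l : List α) : K.chd l ≤ l.length := by
  induction l with
  | nil => simp [chd]
  | cons a l ih =>
    cases l with
    | nil => simp [chd]
    | cons b l =>
      have : K.wt a b ≤ 1 := by unfold wt; split_ifs <;> simp
      simp only [chd, List.length_cons] at ih ⊢
      omega

/-- Every crossing-free spanning path is transformed into one without chords. -/
lemma exists_reach_chordless {l : List α} (hl : K.Good l) (hn : 3 ≤ K.S.card) :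
    ∃ l', K.Reach (K.S.card * (2 * K.S.card + 3)) l l' ∧ K.Good l' ∧ K.chd l' = 0 := by
  have key : ∀ m, ∀ l, K.Good l → K.chd l ≤ m →
      ∃ l', K.Reach (m * (2 * K.S.card + 3)) l l' ∧ K.Good l' ∧ K.chd l' = 0 := by
    intro m
    induction m with
    | zero => exact fun l hl hm => ⟨l, .refl _ _, hl, by omega⟩
    | succ m ih =>
      intro l hl hm
      rcases Nat.eq_zero_or_pos (K.chd l) with h0 | h0
      · exact ⟨l, .refl _ _, hl, h0⟩
      · obtain ⟨l₁, h1, h2, h3⟩ := K.gain_of_chd_pos hl h0 (by rwa [K.length_of_good hl])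
        obtain ⟨l', h4, h5⟩ := ih l₁ h2 (by omega)
        exact ⟨l', (h1.trans h4).mono (by ring_nf; omega), h5⟩
  exact key _ l hl ((K.chd_le l).trans (K.length_of_good hl).le)

lemma nbr_of_chd_zero {l : List α} (h : K.chd l = 0) : l.IsChain K.Nbr := by
  induction l with
  | nil => simp
  | cons a l ih =>
    cases l with
    | nil => simp
    | cons b l =>
      rw [List.isChain_cons_cons]
      simp only [chd, Nat.add_eq_zero_iff] at h
      exact ⟨by_contra fun hn => by rw [K.wt_chord hn] at h; omega, ih h.2⟩

/-- A simple path along the cycle always advances in the same direction. -/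
lemma chain_nx_of_nbr {l : List α} {a b : α} (hl : (a :: b :: l).Nodup)
    (h : (a :: b :: l).IsChain K.Nbr) (hab : K.Nx a b) : (a :: b :: l).IsChain K.Nx := by
  induction l generalizing a b with
  | nil => simpa using hab
  | cons c l ih =>
    rw [List.isChain_cons_cons] at h ⊢
    refine ⟨hab, ih (List.nodup_cons.1 hl).2 h.2 ?_⟩
    refine (List.isChain_cons_cons.1 h.2).1.resolve_right fun hc => ?_
    have := K.nx_unique' hab hc
    subst this
    simp at hl

lemma chain_nx_unique {l l' : List α} {a : α} (hl : (a :: l).IsChain K.Nx)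
    (hl' : (a :: l').IsChain K.Nx) (hlen : l.length = l'.length) : l = l' := by
  induction l generalizing l' a with
  | nil => exact (List.length_eq_zero_iff.1 hlen.symm).symm
  | cons b l ih =>
    rcases l' with _ | ⟨b', l'⟩
    · simp at hlen
    rw [List.isChain_cons_cons] at hl hl'
    obtain rfl := K.nx_unique hl.1 hl'.1
    rw [ih hl.2 hl'.2 (by simpa using hlen)]

/-- The successor of the last vertex of a spanning path along the cycle is the first vertex. -/
lemma nx_last {l : List α} {a z : α} (hl : K.Good (a :: l)) (h : (a :: l).IsChain K.Nx)
    (hz : (a :: l).getLast? = some z) (hl0 : l ≠ []) : K.Nx z a := by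
  have hzl := List.mem_of_mem_getLast? hz
  have haz : z ≠ a := by
    rintro rfl
    obtain ⟨b, l, rfl⟩ := List.exists_cons_of_ne_nil hl0
    rw [List.getLast?_cons_cons] at hz
    exact (List.nodup_cons.1 hl.1).1 (List.mem_of_mem_getLast? hz)
  obtain ⟨b, hb⟩ := K.exists_nx ((hl.2.1 z).1 hzl) ((hl.2.1 a).1 (by simp)) haz
  have hbl := (hl.2.1 b).2 hb.2.1
  obtain ⟨A, B, e⟩ := List.append_of_mem hbl
  rcases List.eq_nil_or_concat A with rfl | ⟨A, x, rfl⟩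
  · cases e; exact hb
  exfalso
  rw [e] at h hz hl
  have hx : K.Nx x b := by
    rw [List.concat_eq_append, List.append_assoc, List.isChain_append] at h
    exact (List.isChain_cons_cons.1 h.2.1).1
  have := K.nx_unique' hb hx
  subst this
  rw [List.getLast?_append_of_ne_nil _ (by simp)] at hz
  have h1 := List.mem_of_mem_getLast? hz
  exact (List.nodup_append.1 hl.1).2.2 z (by simp) z h1 rfl

lemma reach_rotate {l l' : List α} (hl : K.Good l) (hl' : K.Good l') (hc : l.IsChain K.Nx)
    (hc' : l'.IsChain K.Nx) (hn : 3 ≤ K.S.card) : K.Reach 1 l l' := by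
  have h1 := K.length_of_good hl
  have h2 := K.length_of_good hl'
  rcases l' with _ | ⟨a, t⟩
  · simp at h2; omega
  have ha := (hl.2.1 a).2 ((hl'.2.1 a).1 (by simp))
  obtain ⟨A, B, rfl⟩ := List.append_of_mem ha
  rcases A with _ | ⟨b, A⟩
  · simp only [List.nil_append] at h1 hc ⊢
    rw [K.chain_nx_unique hc hc' (by simp at h1 h2; omega)]
    exact .refl _ _
  · obtain ⟨z, hz⟩ : ∃ z, (a :: B).getLast? = some z :=
      ⟨_, List.getLast?_eq_getLast_of_ne_nil (by simp)⟩
    have hnx : K.Nx z b := by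
      refine K.nx_last (l := A ++ a :: B) hl hc ?_ (by simp)
      rw [← List.cons_append, List.getLast?_append_of_ne_nil _ (by simp), hz]
    have st := K.step_rotate hl rfl hz (.inl hnx)
    have hch : (a :: (B ++ b :: A)).IsChain K.Nx := by
      rw [← List.cons_append, List.isChain_append]
      rw [List.isChain_append] at hc
      refine ⟨hc.2.1, hc.1, ?_⟩
      rw [hz]
      rintro x hx y hy
      cases hx; cases hy; exact hnx
    have := K.chain_nx_unique hch hc' (by simp at h1 h2 ⊢; omega)
    rw [← this]
    exact .step st (.refl 0 _)

lemma reach_of_chordless {l l' : List α} (hl : K.Good l) (hl' : K.Good l') (hc : K.chd l = 0)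
    (hc' : K.chd l' = 0) (hn : 3 ≤ K.S.card) : K.Reach 3 l l' := by
  have key : ∀ l, K.Good l → K.chd l = 0 → l.IsChain K.Nx ∨ l.reverse.IsChain K.Nx := by
    intro l hl hc
    have h1 := K.length_of_good hl
    rcases l with _ | ⟨a, _ | ⟨b, t⟩⟩
    · simp
    · simp
    have h := K.nbr_of_chd_zero hc
    rcases (List.isChain_cons_cons.1 h).1 with hab | hab
    · exact .inl (K.chain_nx_of_nbr hl.1 h hab)
    · right
      rw [List.isChain_reverse]
      have h' : (a :: b :: t).IsChain K.rev.Nbr := h.imp fun _ _ => K.nbr_rev.2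
      exact (K.rev.chain_nx_of_nbr hl.1 h' (K.nx_rev.2 hab)).imp fun _ _ h => K.nx_rev.1 h
  have hr := Good.reverse K hl
  have hr' := Good.reverse K hl'
  have s1 := K.step_reverse_all hl
  have s2 := K.step_reverse_all hr'
  rw [List.reverse_reverse] at s2
  rcases key l hl hc with h | h <;> rcases key l' hl' hc' with h' | h'
  · exact (K.reach_rotate hl hl' h h' hn).mono (by omega)
  · exact ((K.reach_rotate hl hr' h h' hn).trans (.step s2 (.refl 0 _))).mono (by omega)
  · exact .mono (.step s1 (K.reach_rotate hr hl' h h' hn)) (by omega)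
  · exact .mono (.step s1 ((K.reach_rotate hr hr' h h' hn).trans (.step s2 (.refl 0 _)))) (by omega)

end ArcConfig

open ArcConfig

lemma mem_edgeSet {l : List Pt} {x y : Pt} : s(x, y) ∈ edgeSet l ↔ Ed l x y := by
  induction l with
  | nil => simp [edgeSet, pathEdges, Ed]
  | cons a l ih =>
    cases l with
    | nil => simp [edgeSet, pathEdges, Ed]
    | cons b l =>
      simp only [edgeSet, pathEdges, List.tail_cons, List.zip_cons_cons, List.map_cons,
        List.toFinset_cons, Finset.mem_insert, Sym2.eq_iff, Ed] at ih ⊢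
      rw [← ih]

lemma mem_of_mem_pathEdges {l : List Pt} {e : Pt × Pt} (h : e ∈ pathEdges l) :
    Ed l e.1 e.2 := by
  rw [← mem_edgeSet, edgeSet, List.mem_toFinset, List.mem_map]
  exact ⟨e, h, rfl⟩

lemma exists_mem_pathEdges {l : List Pt} {x y : Pt} (h : Ed l x y) :
    ∃ e ∈ pathEdges l, s(e.1, e.2) = s(x, y) := by
  rwa [← mem_edgeSet, edgeSet, List.mem_toFinset, List.mem_map] at h

lemma pathEdges_pairwise {l : List Pt} (hl : l.Nodup) :
    (pathEdges l).Pairwise fun e f => s(e.1, e.2) ≠ s(f.1, f.2) := by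
  induction l with
  | nil => simp [pathEdges]
  | cons a l ih =>
    cases l with
    | nil => simp [pathEdges]
    | cons b l =>
      simp only [pathEdges, List.tail_cons, List.zip_cons_cons, List.pairwise_cons] at ih ⊢
      refine ⟨fun f hf he => ?_, ih (List.nodup_cons.1 hl).2⟩
      have h1 := ed_mem (mem_of_mem_pathEdges (l := b :: l) hf)
      have h2 := (List.nodup_cons.1 hl).1
      rw [Sym2.eq_iff] at he
      rcases he with he | he
      · exact h2 (he.1 ▸ h1.1)
      · exact h2 (he.1 ▸ h1.2)

/-- Crossings of segments in a point set are described by the cyclic configuration. -/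
def Models (K : ArcConfig Pt) : Prop :=
  ∀ a ∈ K.S, ∀ b ∈ K.S, ∀ c ∈ K.S, ∀ d ∈ K.S, a ≠ b → c ≠ d → s(a, b) ≠ s(c, d) →
    (openSegment ℝ a b ∩ openSegment ℝ c d = ∅ ↔ ¬ K.X a b c d)

lemma ed_ne {l : List Pt} (hl : l.Nodup) {x y : Pt} (h : Ed l x y) : x ≠ y := by
  induction l with
  | nil => exact h.elim
  | cons a l ih =>
    cases l with
    | nil => exact h.elim
    | cons b l =>
      have h2 := (List.nodup_cons.1 hl).1
      rcases h with (⟨rfl, rfl⟩ | ⟨rfl, rfl⟩) | h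
      · rintro rfl; simp at h2
      · rintro rfl; simp at h2
      · exact ih (List.nodup_cons.1 hl).2 h

lemma isPlanePath_iff {K : ArcConfig Pt} (hK : Models K) {l : List Pt} :
    IsPlanePath K.S l ↔ K.Good l := by
  unfold IsPlanePath Good
  refine and_congr_right fun hl => ?_
  have hS : l.toFinset = K.S ↔ ∀ x, x ∈ l ↔ x ∈ K.S := by
    rw [Finset.ext_iff]; simp
  rw [hS]
  refine and_congr_right fun hm => ?_
  have key : ∀ {a b c d}, Ed l a b → Ed l c d → s(a, b) ≠ s(c, d) →
      (openSegment ℝ a b ∩ openSegment ℝ c d = ∅ ↔ ¬ K.X a b c d) := by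
    intro a b c d h1 h2 hne
    have m1 := ed_mem h1
    have m2 := ed_mem h2
    exact hK _ ((hm _).1 m1.1) _ ((hm _).1 m1.2) _ ((hm _).1 m2.1) _ ((hm _).1 m2.2)
      (ed_ne hl h1) (ed_ne hl h2) hne
  constructor
  · intro h a b c d h1 h2 hx
    by_cases hne : s(a, b) = s(c, d)
    · rw [Sym2.eq_iff] at hne
      rcases hne with ⟨rfl, rfl⟩ | ⟨rfl, rfl⟩
      · exact K.not_x_self hx
      · exact K.not_x_self' hx
    refine (key h1 h2 hne).1 ?_ hx
    obtain ⟨e, he, he'⟩ := exists_mem_pathEdges h1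
    obtain ⟨f, hf, hf'⟩ := exists_mem_pathEdges h2
    have hsym : Std.Symm fun e f : Pt × Pt =>
        openSegment ℝ e.1 e.2 ∩ openSegment ℝ f.1 f.2 = ∅ :=
      ⟨fun e f h => by rwa [Set.inter_comm]⟩
    have hef := List.Pairwise.forall (R := fun e f : Pt × Pt =>
      openSegment ℝ e.1 e.2 ∩ openSegment ℝ f.1 f.2 = ∅) h he hf
      (by rintro rfl; exact hne (he'.symm.trans hf'))
    have seg : ∀ {e : Pt × Pt} {a b : Pt}, s(e.1, e.2) = s(a, b) →
        openSegment ℝ e.1 e.2 = openSegment ℝ a b := by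
      intro e a b h
      rw [Sym2.eq_iff] at h
      rcases h with ⟨h1, h2⟩ | ⟨h1, h2⟩
      · rw [h1, h2]
      · rw [h1, h2, openSegment_symm]
    rwa [seg he', seg hf'] at hef
  · intro h
    refine (pathEdges_pairwise hl).imp_of_mem fun {e f} he hf hne => ?_
    have h1 := mem_of_mem_pathEdges he
    have h2 := mem_of_mem_pathEdges hf
    exact (key h1 h2 hne).2 (h _ _ _ _ h1 h2)

lemma edgeSet_append {A B : List Pt} {z v : Pt} (hz : A.getLast? = some z)
    (hv : B.head? = some v) :
    edgeSet (A ++ B) = insert s(z, v) (edgeSet A ∪ edgeSet B) := by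
  ext e
  induction e with
  | _ x y =>
    rw [Finset.mem_insert, Finset.mem_union, mem_edgeSet, mem_edgeSet, mem_edgeSet, ed_append]
    simp only [Link, hz, hv, Option.some.injEq, Sym2.eq_iff]
    constructor
    · rintro (h | h | ⟨_, _, rfl, rfl, h⟩)
      · exact .inr (.inl h)
      · exact .inr (.inr h)
      · exact .inl h
    · rintro (h | h | h)
      · exact .inr (.inr ⟨_, _, rfl, rfl, h⟩)
      · exact .inl h
      · exact .inr (.inl h)

lemma edgeSet_reverse (l : List Pt) : edgeSet l.reverse = edgeSet l := by
  ext e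
  induction e with
  | _ x y => rw [mem_edgeSet, mem_edgeSet, ed_reverse]

/-- Two plane spanning paths that agree up to a flip. -/
def FlipEq (S : Finset Pt) (P Q : List Pt) : Prop :=
  FlipAdj S P Q ∨ (IsPlanePath S P ∧ IsPlanePath S Q ∧ edgeSet P = edgeSet Q)

lemma FlipEq.symm {S : Finset Pt} {P Q : List Pt} (h : FlipEq S P Q) : FlipEq S Q P := by
  rcases h with ⟨h1, h2, e, f, h3, h4, h5, h6⟩ | ⟨h1, h2, h3⟩
  · exact .inl ⟨h2, h1, f, e, h3.symm, h5, h4, h6.symm⟩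
  · exact .inr ⟨h2, h1, h3.symm⟩

lemma flipEq_of_insert {S : Finset Pt} {P Q : List Pt} {D : Finset (Sym2 Pt)} {e f : Sym2 Pt}
    (hP : IsPlanePath S P) (hQ : IsPlanePath S Q) (h1 : edgeSet P = insert e D)
    (h2 : edgeSet Q = insert f D) (he : e ∉ D) (hf : f ∉ D) : FlipEq S P Q := by
  by_cases hef : e = f
  · subst hef
    exact .inr ⟨hP, hQ, h1.trans h2.symm⟩
  · refine .inl ⟨hP, hQ, e, f, hef, by simp [h1], by simp [h2], ?_⟩
    rw [h1, h2, Finset.erase_insert he, Finset.erase_insert hf]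

lemma notMem_edges {A B : List Pt} (hd : A.Disjoint B) {a b : Pt} (ha : a ∈ A) (hb : b ∈ B) :
    s(a, b) ∉ edgeSet A ∪ edgeSet B := by
  rw [Finset.mem_union, mem_edgeSet, mem_edgeSet]
  rintro (h | h)
  · exact hd (ed_mem h).2 hb
  · exact hd ha (ed_mem h).1

lemma flipEq_of_step {K : ArcConfig Pt} (hK : Models K) {l l' : List Pt} (h : K.Step l l') :
    FlipEq K.S l l' := by
  obtain ⟨h1, h2, A, B, rfl, h3⟩ := h
  have hd : A.Disjoint B := List.disjoint_of_nodup_append h1.1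
  rw [← isPlanePath_iff hK] at h1 h2
  rcases List.eq_nil_or_concat A with rfl | ⟨A', z, rfl⟩
  · refine .inr ⟨h1, h2, ?_⟩
    rcases h3 with rfl | rfl <;> simp
  rcases B with _ | ⟨v, B'⟩
  · refine .inr ⟨h1, h2, ?_⟩
    rcases h3 with rfl | rfl
    · rw [List.append_nil, List.append_nil, edgeSet_reverse]
    · simp
  set A := A'.concat z with hA
  set B := v :: B' with hB
  have hz : A.getLast? = some z := by simp [hA]
  have hv : B.head? = some v := rfl
  obtain ⟨s, hs⟩ : ∃ s, A.head? = some s := ⟨A.head (by simp [hA]), List.head?_eq_some_head _⟩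
  obtain ⟨t, ht⟩ : ∃ t, B.getLast? = some t :=
    ⟨_, List.getLast?_eq_getLast_of_ne_nil (by simp [hB])⟩
  have hzA := List.mem_of_mem_getLast? hz
  have hvB := List.mem_of_mem_head? hv
  have hsA := List.mem_of_mem_head? hs
  have htB := List.mem_of_mem_getLast? ht
  rcases h3 with rfl | rfl
  · refine flipEq_of_insert h1 h2 (edgeSet_append hz hv) (f := s(s, v)) ?_
      (notMem_edges hd hzA hvB) (notMem_edges hd hsA hvB)
    rw [edgeSet_append (z := s) (v := v) (by rw [List.getLast?_reverse, hs]) hv, edgeSet_reverse]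
  · refine flipEq_of_insert h1 h2 (edgeSet_append hz hv) (f := s(s, t)) ?_
      (notMem_edges hd hzA hvB) (notMem_edges hd hsA htB)
    rw [edgeSet_append ht hs, Sym2.eq_swap, Finset.union_comm]

/-- At most `k` flips lead from `P` to `Q`. -/
def Near (S : Finset Pt) (k : ℕ) (P Q : List Pt) : Prop :=
  ∃ j ≤ k, FlipSeq S (fun _ => True) j P Q

lemma near_of_edgeSet_eq {S : Finset Pt} {P Q : List Pt} (hP : IsPlanePath S P)
    (h : edgeSet P = edgeSet Q) : Near S 0 P Q :=
  ⟨0, le_rfl, fun _ => P, rfl, h, fun _ _ => ⟨hP, trivial⟩, fun i hi => by omega⟩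

lemma Near.cons {S : Finset Pt} {k : ℕ} {P P' Q : List Pt} (h : FlipEq S P P')
    (h' : Near S k P' Q) : Near S (k + 1) P Q := by
  obtain ⟨j, hj, f, h0, hk, hp, ha⟩ := h'
  rcases h with h | ⟨h1, h2, h3⟩
  · refine ⟨j + 1, by omega, fun i => if i = 0 then P else f (i - 1), rfl, by simpa using hk, ?_, ?_⟩
    · rintro (_ | i) hi
      · exact ⟨h.1, trivial⟩
      · simpa using hp i (by omega)
    · rintro (_ | i) hi
      · simpa [h0] using h
      · simpa using ha i (by omega)
  · refine ⟨j, by omega, fun i => if i = 0 then P else f i, rfl, ?_, ?_, ?_⟩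
    · rcases j with _ | j
      · simpa [h3, ← h0] using hk
      · simpa using hk
    · rintro (_ | i) hi
      · exact ⟨h1, trivial⟩
      · simpa using hp _ hi
    · rintro (_ | i) hi
      · obtain ⟨-, h5, h6⟩ := ha 0 hi
        rw [h0, ← h3] at h6
        exact ⟨h1, h5, h6⟩
      · simpa using ha _ hi

lemma Near.of_reach {K : ArcConfig Pt} (hK : Models K) {k m : ℕ} {l l' Q : List Pt}
    (h : K.Reach k l l') (h' : Near K.S m l' Q) : Near K.S (m + k) l Q := by
  induction h with
  | refl k =>
    obtain ⟨j, hj, h⟩ := h'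
    exact ⟨j, by omega, h⟩
  | step h1 h2 ih => exact (ih h').cons (flipEq_of_step hK h1)

lemma Near.of_reach' {K : ArcConfig Pt} (hK : Models K) {k m : ℕ} {l l' Q : List Pt}
    (h : K.Reach k l l') (h' : Near K.S m l Q) : Near K.S (m + k) l' Q := by
  induction h generalizing m with
  | refl k =>
    obtain ⟨j, hj, h⟩ := h'
    exact ⟨j, by omega, h⟩
  | step h1 h2 ih =>
    obtain ⟨j, hj, h⟩ := ih (h'.cons (flipEq_of_step hK h1).symm)
    exact ⟨j, by omega, h⟩

lemma near_of_models {K : ArcConfig Pt} (hK : Models K) (hn : 3 ≤ K.S.card) {P Q : List Pt}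
    (hP : IsPlanePath K.S P) (hQ : IsPlanePath K.S Q) : Near K.S (7 * K.S.card ^ 2) P Q := by
  obtain ⟨P', h1, h2, h3⟩ := K.exists_reach_chordless ((isPlanePath_iff hK).1 hP) hn
  obtain ⟨Q', h4, h5, h6⟩ := K.exists_reach_chordless ((isPlanePath_iff hK).1 hQ) hn
  obtain ⟨j, hj, h⟩ := ((((near_of_edgeSet_eq hQ rfl).of_reach' hK h4).of_reach hK
    (K.reach_of_chordless h2 h5 h3 h6 hn)).of_reach hK h1)
  exact ⟨j, by nlinarith, h⟩

lemma edgeSet_eq_of_card_le_two {S : Finset Pt} {P Q : List Pt} (hn : S.card ≤ 2)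
    (hP : IsPlanePath S P) (hQ : IsPlanePath S Q) : edgeSet P = edgeSet Q := by
  obtain ⟨h1, rfl, -⟩ := hP
  obtain ⟨h2, h3, -⟩ := hQ
  have hlen : Q.length = P.length := by
    rw [← List.toFinset_card_of_nodup h1, ← List.toFinset_card_of_nodup h2, h3]
  rw [List.toFinset_card_of_nodup h1] at hn
  rw [Finset.ext_iff] at h3
  rcases P with _ | ⟨a, _ | ⟨b, _ | ⟨c, P⟩⟩⟩ <;>
  rcases Q with _ | ⟨a', _ | ⟨b', _ | ⟨c', Q⟩⟩⟩ <;>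
  simp only [List.length_cons, List.length_nil] at hn hlen <;> try omega
  · rfl
  · rfl
  · have ha := h3 a'
    have hb := h3 b'
    simp at ha hb h1 h2
    have : s(a, b) = s(a', b') := by
      rw [Sym2.eq_iff]
      rcases ha with rfl | rfl <;> rcases hb with rfl | rfl <;> simp_all
    simp [edgeSet, pathEdges, this]

lemma sign3_rot (a b c : Pt) : sign3 b c a = sign3 a b c := by unfold sign3; ring

lemma sign3_swap (a b c : Pt) : sign3 a c b = -sign3 a b c := by unfold sign3; ring

/-- Decomposition of a triangle with respect to a fourth point. -/
lemma sign3_add (a b c d : Pt) : sign3 d b c + sign3 a d c + sign3 a b d = sign3 a b c := by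
  unfold sign3; ring

lemma collinear_of_sign3_eq_zero {a b c : Pt} (hab : a ≠ b) (h : sign3 a b c = 0) :
    Collinear ℝ ({a, b, c} : Set Pt) := by
  rw [collinear_iff_of_mem (p₀ := a) (by simp)]
  refine ⟨b - a, ?_⟩
  have hc : ∃ r : ℝ, c = r • (b - a) +ᵥ a := by
    unfold sign3 at h
    by_cases h1 : b.1 - a.1 = 0
    · have h2 : b.2 - a.2 ≠ 0 := fun h2 => hab (Prod.ext (by linarith) (by linarith))
      refine ⟨(c.2 - a.2) / (b.2 - a.2), Prod.ext ?_ ?_⟩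
      · have : c.1 - a.1 = 0 := by
          rw [h1] at h
          simpa [h2] using h
        simp [h1]; linarith
      · simp [h2]
    · refine ⟨(c.1 - a.1) / (b.1 - a.1), Prod.ext ?_ ?_⟩
      · simp [h1]
      · simp; field_simp; linarith
  rintro p (rfl | rfl | rfl)
  · exact ⟨0, by simp⟩
  · exact ⟨1, by simp⟩
  · exact hc

lemma GenPos.sign3_ne {S : Finset Pt} (hS : GenPos S) {a b c : Pt} (ha : a ∈ S) (hb : b ∈ S)
    (hc : c ∈ S) (hab : a ≠ b) (hac : a ≠ c) (hbc : b ≠ c) : sign3 a b c ≠ 0 := fun h =>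
  hS a ha b hb c hc hab hac hbc (collinear_of_sign3_eq_zero hab h)

/-- A point on the inner side of the three edges of a triangle lies in the triangle. -/
lemma mem_convexHull_of_sign3 {T : Set Pt} {a b c d : Pt} (ha : a ∈ T) (hb : b ∈ T) (hc : c ∈ T)
    (h1 : 0 < sign3 d b c) (h2 : 0 < sign3 a d c) (h3 : 0 < sign3 a b d) :
    d ∈ convexHull ℝ T := by
  have hD := sign3_add a b c d
  set D := sign3 a b c with hDdef
  have hD0 : 0 < D := by linarith
  have key : (sign3 d b c / D) • a + (sign3 a d c / D) • b + (sign3 a b d / D) • c = d := by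
    apply Prod.ext
    · simp only [Prod.fst_add, Prod.smul_fst, smul_eq_mul]
      field_simp
      rw [hDdef]; unfold sign3; ring
    · simp only [Prod.snd_add, Prod.smul_snd, smul_eq_mul]
      field_simp
      rw [hDdef]; unfold sign3; ring
  have hsum := (convex_convexHull ℝ T).sum_mem (t := Finset.univ)
    (w := ![sign3 d b c / D, sign3 a d c / D, sign3 a b d / D]) (z := ![a, b, c])
    (by
      intro i _
      fin_cases i <;> simp <;> positivity)
    (by
      simp only [Fin.sum_univ_three, Matrix.cons_val_zero, Matrix.cons_val_one, Matrix.cons_val]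
      field_simp
      linarith)
    (by
      intro i _
      fin_cases i
      · exact subset_convexHull ℝ T ha
      · exact subset_convexHull ℝ T hb
      · exact subset_convexHull ℝ T hc)
  simpa [Fin.sum_univ_three, key] using hsum

lemma ConvexPos.not_inside {C : Finset Pt} (hC : ConvexPos C) {a b c d : Pt} (ha : a ∈ C)
    (hb : b ∈ C) (hc : c ∈ C) (hd : d ∈ C) (had : a ≠ d) (hbd : b ≠ d) (hcd : c ≠ d)
    (h1 : 0 < sign3 d b c) (h2 : 0 < sign3 a d c) (h3 : 0 < sign3 a b d) : False :=
  hC d hd (mem_convexHull_of_sign3 (by simp [ha, had]) (by simp [hb, hbd]) (by simp [hc, hcd])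
    h1 h2 h3)

lemma ExtremePt.not_inside {S : Finset Pt} {a b c d : Pt} (hd : ExtremePt S d) (ha : a ∈ S)
    (hb : b ∈ S) (hc : c ∈ S) (had : a ≠ d) (hbd : b ≠ d) (hcd : c ≠ d)
    (h1 : 0 < sign3 d b c) (h2 : 0 < sign3 a d c) (h3 : 0 < sign3 a b d) : False :=
  hd.2 (mem_convexHull_of_sign3 (by simp [ha, had]) (by simp [hb, hbd]) (by simp [hc, hcd])
    h1 h2 h3)

/-- In convex position, exactly one edge of a triangle separates a fourth point from it. -/
lemma ConvexPos.signs {S C : Finset Pt} (hS : GenPos S) (hCS : C ⊆ S) (hC : ConvexPos C)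
    {a b c d : Pt} (ha : a ∈ C) (hb : b ∈ C) (hc : c ∈ C) (hd : d ∈ C) (hab : a ≠ b)
    (hac : a ≠ c) (hbc : b ≠ c) (had : a ≠ d) (hbd : b ≠ d) (hcd : c ≠ d)
    (hD : 0 < sign3 a b c) :
    (sign3 d b c < 0 ∧ 0 < sign3 a d c ∧ 0 < sign3 a b d) ∨
    (0 < sign3 d b c ∧ sign3 a d c < 0 ∧ 0 < sign3 a b d) ∨
    (0 < sign3 d b c ∧ 0 < sign3 a d c ∧ sign3 a b d < 0) := by
  have n1 := hS.sign3_ne (hCS hd) (hCS hb) (hCS hc) hbd.symm hcd.symm hbc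
  have n2 := hS.sign3_ne (hCS ha) (hCS hd) (hCS hc) had hac hcd.symm
  have n3 := hS.sign3_ne (hCS ha) (hCS hb) (hCS hd) hab had hbd
  have e := sign3_add a b c d
  have r3 := sign3_rot d b c
  have r4 := sign3_rot b c d
  have r5 := sign3_rot a d c
  have r7 := sign3_rot a b d
  have r8 := sign3_rot b d a
  have s1 := sign3_swap b d c
  have s2 := sign3_swap c d b
  have s4 := sign3_swap a d c
  have s5 := sign3_swap d c a
  have s7 := sign3_swap a b d
  have s9 := sign3_swap d a b
  rcases n1.lt_or_gt with h1 | h1 <;> rcases n2.lt_or_gt with h2 | h2 <;>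
    rcases n3.lt_or_gt with h3 | h3
  · linarith
  · exact (hC.not_inside ha hb hd hc hac hbc hcd.symm (by linarith) (by linarith)
      (by linarith)).elim
  · exact (hC.not_inside ha hd hc hb hab hbd.symm hbc.symm (by linarith) (by linarith)
      (by linarith)).elim
  · exact .inl ⟨h1, h2, h3⟩
  · exact (hC.not_inside hd hb hc ha had.symm hab.symm hac.symm (by linarith) (by linarith)
      (by linarith)).elim
  · exact .inr (.inl ⟨h1, h2, h3⟩)
  · exact .inr (.inr ⟨h1, h2, h3⟩)
  · exact (hC.not_inside ha hb hc hd had hbd hcd h1 h2 h3).elim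

namespace IsConcaveChain

variable {S C : Finset Pt} {p q : Pt}

lemma symm (h : IsConcaveChain S C p q) : IsConcaveChain S C q p := by
  obtain ⟨h1, h2, h3, h4, h5, h6, h7, h8, h9⟩ := h
  exact ⟨h1, h3, h2, h4.symm, h6, h5, h7, fun x hx he => (h8 x hx he).symm,
    fun x hx y hy hxy z hz hzC => ⟨(h9 x hx y hy hxy z hz hzC).1, (h9 x hx y hy hxy z hz hzC).2.2,
      (h9 x hx y hy hxy z hz hzC).2.1⟩⟩

lemma side (h : IsConcaveChain S C p q) (hS : GenPos S) {x y z : Pt} (hx : x ∈ C) (hy : y ∈ C)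
    (hxy : x ≠ y) (hz : z ∈ S) (hzC : z ∉ C) (hpx : p ≠ x) (hpy : p ≠ y) :
    (0 < sign3 x y p ∧ sign3 x y z < 0) ∨ (sign3 x y p < 0 ∧ 0 < sign3 x y z) := by
  obtain ⟨h1, h2, -, -, -, -, -, -, h9⟩ := h
  have n1 := hS.sign3_ne (h1 hx) (h1 hy) (h1 h2) hxy hpx.symm hpy.symm
  obtain ⟨n2, h10, -⟩ := h9 x hx y hy hxy z hz hzC
  rcases n1.lt_or_gt with h3 | h3 <;> rcases n2.lt_or_gt with h4 | h4
  · nlinarith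
  · exact .inr ⟨h3, h4⟩
  · exact .inl ⟨h3, h4⟩
  · nlinarith

/-- A point off the chain is separated from every triangle of chain points by exactly two of its
edges. -/
lemma signs (h : IsConcaveChain S C p q) (hS : GenPos S) {x y w z : Pt} (hx : x ∈ C) (hy : y ∈ C)
    (hw : w ∈ C) (hxy : x ≠ y) (hxw : x ≠ w) (hyw : y ≠ w) (hz : z ∈ S) (hzC : z ∉ C)
    (hD : 0 < sign3 x y w) :
    (0 < sign3 z y w ∧ sign3 x z w < 0 ∧ sign3 x y z < 0) ∨
    (sign3 z y w < 0 ∧ 0 < sign3 x z w ∧ sign3 x y z < 0) ∨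
    (sign3 z y w < 0 ∧ sign3 x z w < 0 ∧ 0 < sign3 x y z) := by
  have e := sign3_add x y w z
  have r1 := sign3_rot x y w
  have r2 := sign3_rot y w x
  have t1 := sign3_rot z y w
  have t2 := sign3_rot w x z
  have key : ∀ p q, IsConcaveChain S C p q → p ≠ x → p ≠ y → p ≠ w →
      (0 < sign3 z y w ∧ sign3 x z w < 0 ∧ sign3 x y z < 0) ∨
      (sign3 z y w < 0 ∧ 0 < sign3 x z w ∧ sign3 x y z < 0) ∨
      (sign3 z y w < 0 ∧ sign3 x z w < 0 ∧ 0 < sign3 x y z) := by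
    intro p q h h1 h2 h3
    have s1 := h.side hS hx hy hxy hz hzC h1 h2
    have s2 := h.side hS hy hw hyw hz hzC h2 h3
    have s3 := h.side hS hw hx hxw.symm hz hzC h3 h1
    have t4 := sign3_rot p y w
    have t5 := sign3_rot w x p
    rcases h.2.2.2.2.2.2.1.signs hS h.1 hx hy hw h.2.1 hxy hxw hyw h1.symm h2.symm h3.symm hD with
      s4 | s4 | s4
    · exact .inl ⟨by rcases s2 with s | s <;> linarith, by rcases s3 with s | s <;> linarith,
        by rcases s1 with s | s <;> linarith⟩
    · exact .inr (.inl ⟨by rcases s2 with s | s <;> linarith,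
        by rcases s3 with s | s <;> linarith, by rcases s1 with s | s <;> linarith⟩)
    · exact .inr (.inr ⟨by rcases s2 with s | s <;> linarith,
        by rcases s3 with s | s <;> linarith, by rcases s1 with s | s <;> linarith⟩)
  by_cases hp : p ≠ x ∧ p ≠ y ∧ p ≠ w
  · exact key p q h hp.1 hp.2.1 hp.2.2
  by_cases hq : q ≠ x ∧ q ≠ y ∧ q ≠ w
  · exact key q p h.symm hq.1 hq.2.1 hq.2.2
  have hpq := h.2.2.2.1
  have pos : ∀ {a b : Pt}, a ∈ C → b ∈ C → a ≠ b → ∀ {c : Pt}, (c = p ∨ c = q) → c ≠ a → c ≠ b →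
      0 < sign3 a b c → sign3 a b z < 0 := by
    intro a b ha hb hab c hc hca hcb h0
    rcases hc with rfl | rfl
    · rcases h.side hS ha hb hab hz hzC hca hcb with s | s <;> linarith
    · rcases h.symm.side hS ha hb hab hz hzC hca hcb with s | s <;> linarith
  have px : (x = p ∨ x = q) → sign3 z y w < 0 := fun hc => by
    have := pos hy hw hyw hc hxy hxw (by linarith)
    linarith
  have py : (y = p ∨ y = q) → sign3 x z w < 0 := fun hc => by
    have := pos hw hx hxw.symm hc hyw hxy.symm (by linarith)
    linarith
  have pw : (w = p ∨ w = q) → sign3 x y z < 0 := fun hc => by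
    exact pos hx hy hxy hc hxw.symm hyw.symm (by linarith)
  have : ((x = p ∨ x = q) ∧ (y = p ∨ y = q)) ∨ ((x = p ∨ x = q) ∧ (w = p ∨ w = q)) ∨
      ((y = p ∨ y = q) ∧ (w = p ∨ w = q)) := by
    by_cases a1 : p = x
    · subst a1; by_cases a2 : q = y
      · simp [a2]
      · by_cases a3 : q = w
        · simp [a3]
        · exact (hq ⟨hpq.symm, a2, a3⟩).elim
    by_cases a2 : p = y
    · subst a2; by_cases a3 : q = x
      · simp [a3]
      · by_cases a4 : q = w
        · simp [a4]
        · exact (hq ⟨a3, hpq.symm, a4⟩).elim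
    by_cases a3 : p = w
    · subst a3; by_cases a4 : q = x
      · simp [a4]
      · by_cases a5 : q = y
        · simp [a5]
        · exact (hq ⟨a4, a5, hpq.symm⟩).elim
    exact (hp ⟨a1, a2, a3⟩).elim
  rcases this with ⟨h1, h2⟩ | ⟨h1, h2⟩ | ⟨h1, h2⟩
  · have h1 := px h1; have h2 := py h2
    exact .inr (.inr ⟨h1, h2, by linarith⟩)
  · have h1 := px h1; have h2 := pw h2
    exact .inr (.inl ⟨h1, by linarith, h2⟩)
  · have h1 := py h1; have h2 := pw h2
    exact .inl ⟨by linarith, h1, h2⟩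

/-- The points off the chain lie on the same side of the line through the ends as the chain. -/
lemma side_ends (h : IsConcaveChain S C p q) (hS : GenPos S) {c z : Pt} (hc : c ∈ C) (hcp : c ≠ p)
    (hcq : c ≠ q) (hz : z ∈ S) (hzC : z ∉ C) :
    (0 < sign3 p q c ∧ 0 < sign3 p q z) ∨ (sign3 p q c < 0 ∧ sign3 p q z < 0) := by
  have hpq := h.2.2.2.1
  have s1 := h.side hS hc h.2.2.1 hcq hz hzC hcp.symm hpq
  have s2 := h.symm.side hS hc h.2.1 hcp hz hzC hcq.symm hpq.symm
  have e := sign3_add p q c z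
  have t1 := sign3_rot p q c
  have t2 := sign3_rot q c p
  have t5 := sign3_rot z q c
  have t6 := sign3_rot q c z
  have t7 := sign3_swap c q z
  have t8 := sign3_rot p z c
  have t9 := sign3_rot z c p
  have t11 := sign3_swap c p q
  rcases s1 with s1 | s1 <;> rcases s2 with s2 | s2
  · linarith
  · right; constructor <;> linarith
  · left; constructor <;> linarith
  · linarith

lemma same_side (h : IsConcaveChain S C p q) (hS : GenPos S) (h3 : 3 ≤ C.card) {x y z w : Pt}
    (hx : x ∈ C) (hy : y ∈ C) (hxy : x ≠ y) (hz : z ∈ S) (hzC : z ∉ C) (hw : w ∈ S)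
    (hwC : w ∉ C) (h1 : 0 < sign3 x y z) : 0 < sign3 x y w := by
  by_cases hp : p ≠ x ∧ p ≠ y
  · have s1 := h.side hS hx hy hxy hz hzC hp.1 hp.2
    have s2 := h.side hS hx hy hxy hw hwC hp.1 hp.2
    rcases s1 with s1 | s1 <;> rcases s2 with s2 | s2 <;> linarith
  by_cases hq : q ≠ x ∧ q ≠ y
  · have s1 := h.symm.side hS hx hy hxy hz hzC hq.1 hq.2
    have s2 := h.symm.side hS hx hy hxy hw hwC hq.1 hq.2
    rcases s1 with s1 | s1 <;> rcases s2 with s2 | s2 <;> linarith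
  have hpq := h.2.2.2.1
  obtain ⟨c, hc, hcn⟩ : ∃ c ∈ C, c ∉ ({p, q} : Finset Pt) := by
    by_contra hn
    push Not at hn
    have := Finset.card_le_card (show C ⊆ {p, q} from hn)
    have := Finset.card_le_two (a := p) (b := q)
    omega
  simp only [Finset.mem_insert, Finset.mem_singleton, not_or] at hcn
  have hxy' : (x = p ∧ y = q) ∨ (x = q ∧ y = p) := by
    by_cases h1 : p = x
    · subst h1
      by_cases h2 : q = y
      · exact .inl ⟨rfl, h2.symm⟩
      · exact (hq ⟨hpq.symm, h2⟩).elim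
    by_cases h2 : p = y
    · subst h2
      by_cases h3 : q = x
      · exact .inr ⟨h3.symm, rfl⟩
      · exact (hq ⟨h3, hpq.symm⟩).elim
    exact (hp ⟨h1, h2⟩).elim
  rcases hxy' with ⟨rfl, rfl⟩ | ⟨rfl, rfl⟩
  · have s1 := h.side_ends hS hc hcn.1 hcn.2 hz hzC
    have s2 := h.side_ends hS hc hcn.1 hcn.2 hw hwC
    rcases s1 with s1 | s1 <;> rcases s2 with s2 | s2 <;> linarith
  · have s1 := h.symm.side_ends hS hc hcn.2 hcn.1 hz hzC
    have s2 := h.symm.side_ends hS hc hcn.2 hcn.1 hw hwC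
    rcases s1 with s1 | s1 <;> rcases s2 with s2 | s2 <;> linarith

end IsConcaveChain

namespace GDCOn

variable {S : Finset Pt} (g : GDCOn S)

/-- The chains with at least one interior point. -/
def Big (C : Finset Pt) : Prop := C ∈ g.chains ∧ 3 ≤ C.card

/-- Three points on a common chain. -/
def Mono (a b c : Pt) : Prop := ∃ C, g.Big C ∧ a ∈ C ∧ b ∈ C ∧ c ∈ C

/-- The cyclic order of the points along the polygon formed by the chains. -/
def Btw (a b c : Pt) : Prop :=
  (a ∈ S ∧ b ∈ S ∧ c ∈ S ∧ a ≠ b ∧ a ≠ c ∧ b ≠ c) ∧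
    (g.Mono a b c → sign3 a b c < 0) ∧ (¬ g.Mono a b c → 0 < sign3 a b c)

variable {g}

lemma sub {C : Finset Pt} (hC : C ∈ g.chains) : C ⊆ S := by
  obtain ⟨p, q, h⟩ := g.chains_concave C hC
  exact h.1

lemma extreme_of_two {C C' : Finset Pt} (hC : C ∈ g.chains) (hC' : C' ∈ g.chains) (hne : C ≠ C')
    {x : Pt} (hx : x ∈ C) (hx' : x ∈ C') : ExtremePt S x := by
  by_contra hn
  have h := g.interior_mem x (sub hC hx) hn
  rw [Finset.card_eq_one] at h
  obtain ⟨D, hD⟩ := h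
  have h1 : C ∈ ({D} : Finset (Finset Pt)) := by rw [← hD]; simp [hC, hx]
  have h2 : C' ∈ ({D} : Finset (Finset Pt)) := by rw [← hD]; simp [hC', hx']
  rw [Finset.mem_singleton] at h1 h2
  exact hne (h1.trans h2.symm)

lemma end_of_two {C C' : Finset Pt} {p q : Pt} (h : IsConcaveChain S C p q) (hC : C ∈ g.chains)
    (hC' : C' ∈ g.chains) (hne : C ≠ C') {x : Pt} (hx : x ∈ C) (hx' : x ∈ C') :
    x = p ∨ x = q :=
  h.2.2.2.2.2.2.2.1 x hx (extreme_of_two hC hC' hne hx hx')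

lemma two {C C' C'' : Finset Pt} (hC : C ∈ g.chains) (hC' : C' ∈ g.chains) (hC'' : C'' ∈ g.chains)
    (hne : C ≠ C') {x : Pt} (hx : x ∈ C) (hx' : x ∈ C') (hx'' : x ∈ C'') :
    C'' = C ∨ C'' = C' := by
  have h := g.extreme_mem x (sub hC hx) (extreme_of_two hC hC' hne hx hx')
  have h2 : ({C, C'} : Finset (Finset Pt)) = g.chains.filter fun C => x ∈ C := by
    refine Finset.eq_of_subset_of_card_le ?_ ?_
    · intro D hD
      rw [Finset.mem_insert, Finset.mem_singleton] at hD
      rcases hD with rfl | rfl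
      · simp [hC, hx]
      · simp [hC', hx']
    · rw [h, Finset.card_pair hne]
  have h3 : C'' ∈ ({C, C'} : Finset (Finset Pt)) := by rw [h2]; simp [hC'', hx'']
  simpa using h3

lemma Big.exists_interior {C : Finset Pt} (hC : g.Big C) (p q : Pt) :
    ∃ c ∈ C, c ≠ p ∧ c ≠ q := by
  by_contra hn
  push Not at hn
  have h1 := hC.2
  have := Finset.card_le_card (show C ⊆ {p, q} from fun c hc => by
    rw [Finset.mem_insert, Finset.mem_singleton]
    exact or_iff_not_imp_left.2 (hn c hc))
  have := Finset.card_le_two (a := p) (b := q)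
  omega

lemma inter (hS : GenPos S) {C C' : Finset Pt} (hC : g.Big C) (hC' : g.Big C') (hne : C ≠ C')
    {x y : Pt} (hx : x ∈ C) (hx' : x ∈ C') (hy : y ∈ C) (hy' : y ∈ C') : x = y := by
  by_contra hxy
  obtain ⟨c, hc, hcx, hcy⟩ := hC.exists_interior x y
  obtain ⟨d, hd, hdx, hdy⟩ := hC'.exists_interior x y
  have ends : ∀ {D D' : Finset Pt}, D ∈ g.chains → D' ∈ g.chains → D ≠ D' → x ∈ D → x ∈ D' →
      y ∈ D → y ∈ D' → IsConcaveChain S D x y := by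
    intro D D' hD hD' hne h1 h2 h3 h4
    obtain ⟨p, q, h⟩ := g.chains_concave D hD
    rcases end_of_two h hD hD' hne h1 h2 with rfl | rfl <;>
    rcases end_of_two h hD hD' hne h3 h4 with rfl | rfl
    · exact (hxy rfl).elim
    · exact h
    · exact h.symm
    · exact (hxy rfl).elim
  have e1 := ends hC.1 hC'.1 hne hx hx' hy hy'
  have e2 := ends hC'.1 hC.1 hne.symm hx' hx hy' hy
  have hcC' : c ∉ C' := fun h => (end_of_two e1 hC.1 hC'.1 hne hc h).elim hcx hcy
  have hdC : d ∉ C := fun h => (end_of_two e2 hC'.1 hC.1 hne.symm hd h).elim hdx hdy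
  have hcS := sub hC.1 hc
  have hdS := sub hC'.1 hd
  have s1 := e1.side hS hc hy hcy hdS hdC hcx.symm hxy
  have s2 := e1.symm.side hS hc hx hcx hdS hdC hcy.symm (Ne.symm hxy)
  have s3 := e2.side hS hd hy' hdy hcS hcC' hdx.symm hxy
  have s4 := e2.symm.side hS hd hx' hdx hcS hcC' hdy.symm (Ne.symm hxy)
  have t1 := e1.side_ends hS hc hcx hcy hdS hdC
  have a5 := sign3_rot d c x
  have b3 := sign3_rot c x y
  have b7 := sign3_rot d x y
  have b9 := sign3_swap d x c
  rcases t1 with t1 | t1 <;> rcases s1 with s1 | s1 <;> rcases s2 with s2 | s2 <;>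
    rcases s3 with s3 | s3 <;> rcases s4 with s4 | s4 <;> linarith

lemma mono_rot {a b c : Pt} : g.Mono b c a ↔ g.Mono a b c := by
  unfold Mono; constructor <;> rintro ⟨C, h1, h2, h3, h4⟩
  · exact ⟨C, h1, h4, h2, h3⟩
  · exact ⟨C, h1, h3, h4, h2⟩

lemma mono_swap {a b c : Pt} : g.Mono a c b ↔ g.Mono a b c := by
  unfold Mono; constructor <;> rintro ⟨C, h1, h2, h3, h4⟩ <;> exact ⟨C, h1, h2, h4, h3⟩

lemma not_mono (hS : GenPos S) {C : Finset Pt} (hC : g.Big C) {x y z : Pt} (hx : x ∈ C)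
    (hy : y ∈ C) (hxy : x ≠ y) (hz : z ∉ C) : ¬ g.Mono x y z := by
  rintro ⟨D, hD, h1, h2, h3⟩
  by_cases h : C = D
  · exact hz (h ▸ h3)
  · exact hxy (inter hS hC hD h hx h1 hy h2)

/-- A triangle containing another point has three of the four points on a common chain. -/
lemma no_inside (hS : GenPos S) {a b c d : Pt} (ha : a ∈ S) (hb : b ∈ S) (hc : c ∈ S) (hd : d ∈ S)
    (hab : a ≠ b) (hac : a ≠ c) (had : a ≠ d) (m1 : ¬ g.Mono a b c) (m2 : ¬ g.Mono a c d)
    (m3 : ¬ g.Mono a d b) (h1 : 0 < sign3 a b c) (h2 : 0 < sign3 a c d) (h3 : 0 < sign3 a d b) :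
    False := by
  have r5 := sign3_rot a b c
  have r6 := sign3_rot b a d
  have hn : ¬ ExtremePt S a := fun h =>
    h.not_inside hb hc hd hab.symm hac.symm had.symm h2 (by linarith) (by linarith)
  have h := g.interior_mem a ha hn
  obtain ⟨C, hC⟩ := Finset.card_pos.1 (show 0 < (g.chains.filter fun C => a ∈ C).card by omega)
  rw [Finset.mem_filter] at hC
  obtain ⟨hC, haC⟩ := hC
  obtain ⟨p, q, hpq⟩ := g.chains_concave C hC
  have hap : a ≠ p := by rintro rfl; exact hn hpq.2.2.2.2.1
  have haq : a ≠ q := by rintro rfl; exact hn hpq.2.2.2.2.2.1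
  have hbig : g.Big C := ⟨hC, by
    have : ({a, p, q} : Finset Pt) ⊆ C := by
      intro x hx
      simp only [Finset.mem_insert, Finset.mem_singleton] at hx
      rcases hx with rfl | rfl | rfl
      exacts [haC, hpq.2.1, hpq.2.2.1]
    have h1 := Finset.card_le_card this
    rwa [Finset.card_eq_three.2 ⟨a, p, q, hap, haq, hpq.2.2.2.1, rfl⟩] at h1⟩
  have one : ∀ {b c d : Pt}, b ∈ C → c ∈ S → d ∈ S → a ≠ b → c ∉ C → d ∉ C →
      0 < sign3 a b c → 0 < sign3 a d b → False := by
    intro b c d hb hc hd hab hcC hdC h1 h2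
    have := hpq.same_side hS hbig.2 haC hb hab hc hcC hd hdC h1
    have := sign3_swap a b d
    linarith
  by_cases hbC : b ∈ C
  · have hcC : c ∉ C := fun h => m1 ⟨C, hbig, haC, hbC, h⟩
    have hdC : d ∉ C := fun h => m3 ⟨C, hbig, haC, h, hbC⟩
    exact one hbC hc hd hab hcC hdC h1 h3
  by_cases hcC : c ∈ C
  · have hdC : d ∉ C := fun h => m2 ⟨C, hbig, haC, hcC, h⟩
    exact one hcC hd hb hac hdC hbC h2 h1
  by_cases hdC : d ∈ C
  · exact one hdC hb hc had hbC hcC h3 h2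
  have key : sign3 a c d * sign3 a p b + sign3 a d b * sign3 a p c + sign3 a b c * sign3 a p d = 0 := by
    unfold sign3; ring
  have hp := hpq.2.1
  rcases (hS.sign3_ne ha (sub hC hp) hb hap hab (by rintro rfl; exact hbC hp)).lt_or_gt with h0 | h0
  · have hpa : ∀ {x y : Pt}, x ∈ S → x ∉ C → y ∈ S → y ∉ C → sign3 a p x < 0 →
        sign3 a p y < 0 := by
      intro x y hx hxC hy hyC h
      have := hpq.same_side hS hbig.2 hp haC hap.symm hx hxC hy hyC
        (by have := sign3_swap x a p; have := sign3_rot a p x; have := sign3_rot x p a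
            have := sign3_rot p a x; have := sign3_rot x a p; linarith)
      have := sign3_swap y a p
      have := sign3_rot y p a
      have := sign3_rot y a p
      linarith
    have i1 := hpa hb hbC hc hcC h0
    have i2 := hpa hb hbC hd hdC h0
    nlinarith [mul_pos h2 (neg_pos.2 h0), mul_pos h3 (neg_pos.2 i1), mul_pos h1 (neg_pos.2 i2)]
  · have i1 := hpq.same_side hS hbig.2 haC hp hap hb hbC hc hcC h0
    have i2 := hpq.same_side hS hbig.2 haC hp hap hb hbC hd hdC h0
    nlinarith [mul_pos h2 h0, mul_pos h3 i1, mul_pos h1 i2]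

lemma btw_rot {a b c : Pt} (h : g.Btw a b c) : g.Btw b c a := by
  obtain ⟨⟨ha, hb, hc, hab, hac, hbc⟩, h1, h2⟩ := h
  refine ⟨⟨hb, hc, ha, hbc, hab.symm, hac.symm⟩, ?_, ?_⟩
  · rw [mono_rot, sign3_rot]; exact h1
  · rw [mono_rot, sign3_rot]; exact h2

lemma btw_asymm {a b c : Pt} (h : g.Btw a b c) : ¬ g.Btw a c b := by
  rintro ⟨-, h1, h2⟩
  rw [mono_swap, sign3_swap] at h1 h2
  by_cases hm : g.Mono a b c
  · linarith [h1 hm, h.2.1 hm]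
  · linarith [h2 hm, h.2.2 hm]

lemma btw_total (hS : GenPos S) {a b c : Pt} (ha : a ∈ S) (hb : b ∈ S) (hc : c ∈ S) (hab : a ≠ b)
    (hac : a ≠ c) (hbc : b ≠ c) : g.Btw a b c ∨ g.Btw a c b := by
  have h' : g.Mono a c b ↔ g.Mono a b c := mono_swap
  simp only [Btw, h', sign3_swap a b c]
  by_cases hm : g.Mono a b c <;>
    rcases (hS.sign3_ne ha hb hc hab hac hbc).lt_or_gt with h | h <;>
    simp [hm, h, ha, hb, hc, hab, hac, hbc, hbc.symm]

lemma btw_not_around (hS : GenPos S) {a b c d : Pt} (h1 : g.Btw a b c) (h2 : g.Btw a c d) :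
    ¬ g.Btw a d b := by
  intro h3
  have key : ∀ {b c d : Pt}, g.Btw a b c → g.Btw a c d → g.Btw a d b → ¬ g.Mono a b c := by
    rintro b c d h1 h2 h3 ⟨C, hC, ha, hb, hc⟩
    obtain ⟨p, q, hpq⟩ := g.chains_concave C hC.1
    obtain ⟨⟨haS, hbS, hcS, hab, hac, hbc⟩, h1, -⟩ := h1
    obtain ⟨⟨-, -, hdS, -, had, hcd⟩, h2, h2'⟩ := h2
    obtain ⟨⟨-, -, -, -, -, hdb⟩, h3, h3'⟩ := h3
    have h1 := h1 ⟨C, hC, ha, hb, hc⟩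
    by_cases hd : d ∈ C
    · have h2 := h2 ⟨C, hC, ha, hc, hd⟩
      have h3 := h3 ⟨C, hC, ha, hd, hb⟩
      have := sign3_swap a c d
      have := sign3_rot b a c
      have := sign3_swap a b c
      have := sign3_swap a d b
      have := sign3_rot a b d
      exact hpq.2.2.2.2.2.2.1.not_inside hb hd hc ha hab.symm had.symm hac.symm
        (by linarith) (by linarith) (by linarith)
    · have h2 := h2' (not_mono hS hC ha hc hac hd)
      have h3 := h3' (fun h => not_mono hS hC ha hb hab hd (mono_swap.1 h))
      rcases hpq.signs hS ha hc hb hac hab hbc.symm hdS hd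
        (by have := sign3_swap a b c; linarith) with s | s | s <;> linarith
  have m1 := key h1 h2 h3
  have m2 := key h2 h3 h1
  have m3 := key h3 h1 h2
  exact no_inside hS h1.1.1 h1.1.2.1 h1.1.2.2.1 h2.1.2.2.1 h1.1.2.2.2.1 h2.1.2.2.2.1
    h2.1.2.2.2.2.1 m1 m2 m3 (h1.2.2 m1) (h2.2.2 m2) (h3.2.2 m3)

/-- The combinatorial configuration of a generalized double circle. -/
def config (g : GDCOn S) (hS : GenPos S) : ArcConfig Pt where
  S := S
  B := g.Btw
  chains := {C | g.Big C}
  mem h := ⟨h.1.1, h.1.2.1, h.1.2.2.1⟩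
  rot := btw_rot
  asymm := btw_asymm
  total := btw_total hS
  trans {a b c d} h1 h2 := by
    have hbd : b ≠ d := by rintro rfl; exact btw_asymm h1 h2
    exact (btw_total hS h1.1.1 h1.1.2.1 h2.1.2.2.1 h1.1.2.2.2.1 h2.1.2.2.2.2.1 hbd).resolve_right
      (btw_not_around hS h1 h2)
  sub C hC := sub hC.1
  contig C hC x hx y hy z hz w hw hzC hwC h1 h2 := by
    obtain ⟨p, q, hpq⟩ := g.chains_concave C hC.1
    have hxy := h1.1.2.2.2.2.1
    have h1 := h1.2.2 fun h => not_mono hS hC hx hy hxy hzC (mono_swap.1 h)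
    have h2 := h2.2.2 fun h => not_mono hS hC hy hx hxy.symm hwC (mono_swap.1 h)
    have := hpq.same_side hS hC.2 hy hx hxy.symm hz hzC hw hwC
      (by have := sign3_rot y x z; linarith)
    have := sign3_swap y x w
    linarith
  inter C hC C' hC' hne x hx hx' y hy hy' := inter hS hC hC' hne hx hx' hy hy'
  two C hC C' hC' C'' hC'' hne y hy hy' hy'' := two hC.1 hC'.1 hC''.1 hne hy hy' hy''
  ends C hC := by
    obtain ⟨p, q, hpq⟩ := g.chains_concave C hC.1
    refine ⟨p, hpq.2.1, q, hpq.2.2.1, hpq.2.2.2.1,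
      fun x hx C' hC' hne hx' => end_of_two hpq hC.1 hC'.1 hne.symm hx hx', ?_⟩
    intro c hc z hz hzC hcp hcq
    have hp := hpq.2.1
    have hq := hpq.2.2.1
    have hne := hpq.2.2.2.1
    have hzp : z ≠ p := by rintro rfl; exact hzC hp
    have hzq : z ≠ q := by rintro rfl; exact hzC hq
    have m : g.Mono p c q := ⟨C, hC, hp, hc, hq⟩
    have m' : ¬ g.Mono p q z := not_mono hS hC hp hq hne hzC
    have s1 := sign3_swap p q c
    have s2 := sign3_swap p q z
    rcases btw_total hS (g := g) (sub hC.1 hp) (sub hC.1 hc) (sub hC.1 hq) hcp.symm hne hcq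
      with h1 | h1 <;>
    rcases btw_total hS (g := g) (sub hC.1 hp) hz (sub hC.1 hq) hzp.symm hne hzq with h2 | h2
    · exfalso
      have h1 := h1.2.1 m
      have h2 := h2.2.2 fun h => m' (mono_swap.1 h)
      rcases hpq.side_ends hS hc hcp hcq hz hzC with s | s <;> linarith
    · exact .inl ⟨h1, btw_rot h2⟩
    · exact .inr ⟨h2, btw_rot h1⟩
    · exfalso
      have h1 := h1.2.1 (mono_swap.2 m)
      have h2 := h2.2.2 m'
      rcases hpq.side_ends hS hc hcp hcq hz hzC with s | s <;> linarith

end GDCOn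

/-- The open segments `ab` and `cd` cross, in terms of orientations. -/
def Cross (a b c d : Pt) : Prop :=
  sign3 a b c * sign3 a b d < 0 ∧ sign3 c d a * sign3 c d b < 0

lemma cross_symm {a b c d : Pt} : Cross c d a b ↔ Cross a b c d := and_comm

lemma cross_comm_right {a b c d : Pt} : Cross a b d c ↔ Cross a b c d := by
  unfold Cross
  rw [show sign3 a b d * sign3 a b c = sign3 a b c * sign3 a b d by ring,
    show sign3 d c a * sign3 d c b = sign3 c d a * sign3 c d b by unfold sign3; ring]

lemma sign3_combo {u v : ℝ} (h : u + v = 1) (a b c d : Pt) :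
    sign3 a b (u • c + v • d) = u * sign3 a b c + v * sign3 a b d := by
  obtain rfl : v = 1 - u := by linarith
  simp only [sign3, Prod.fst_add, Prod.snd_add, Prod.smul_fst, Prod.smul_snd, smul_eq_mul]
  ring

lemma sign3_openSegment {a b x : Pt} (hx : x ∈ openSegment ℝ a b) : sign3 a b x = 0 := by
  obtain ⟨u, v, -, -, h, rfl⟩ := hx
  rw [sign3_combo h]
  unfold sign3; ring

lemma mul_neg_of_mem {a b c d x : Pt} (hc : sign3 a b c ≠ 0) (hx : x ∈ openSegment ℝ a b)
    (hx' : x ∈ openSegment ℝ c d) : sign3 a b c * sign3 a b d < 0 := by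
  have h0 := sign3_openSegment hx
  obtain ⟨u, v, hu, hv, h, rfl⟩ := hx'
  rw [sign3_combo h] at h0
  have h1 : v * (sign3 a b c * sign3 a b d) = -(u * sign3 a b c ^ 2) := by
    linear_combination sign3 a b c * h0
  have h2 : 0 < u * sign3 a b c ^ 2 := by positivity
  by_contra hn
  nlinarith [mul_nonneg hv.le (not_lt.1 hn)]

lemma mem_openSegment_of_mul_neg {a b : Pt} {s t : ℝ} (h : s * t < 0) :
    (t / (t - s)) • a + (-s / (t - s)) • b ∈ openSegment ℝ a b := by
  have hne : t - s ≠ 0 := fun h0 => by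
    obtain rfl : t = s := by linarith
    nlinarith [mul_self_nonneg t]
  refine ⟨_, _, ?_, ?_, ?_, rfl⟩
  · rw [← mul_div_mul_right _ _ hne]
    refine div_pos ?_ (mul_self_pos.2 hne)
    nlinarith [mul_self_nonneg t]
  · rw [← mul_div_mul_right _ _ hne]
    refine div_pos ?_ (mul_self_pos.2 hne)
    nlinarith [mul_self_nonneg s]
  · field_simp
    ring

lemma inter_openSegment_eq_empty_iff {a b c d : Pt} (h1 : sign3 a b c ≠ 0)
    (h2 : sign3 c d a ≠ 0) : openSegment ℝ a b ∩ openSegment ℝ c d = ∅ ↔ ¬ Cross a b c d := by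
  rw [← Set.not_nonempty_iff_eq_empty, not_iff_not]
  constructor
  · rintro ⟨x, hx, hx'⟩
    exact ⟨mul_neg_of_mem h1 hx hx', mul_neg_of_mem h2 hx' hx⟩
  · rintro ⟨h3, h4⟩
    refine ⟨_, mem_openSegment_of_mul_neg h4, ?_⟩
    have hN : sign3 c d b - sign3 c d a = sign3 a b c - sign3 a b d := by unfold sign3; ring
    have hN0 : sign3 a b c - sign3 a b d ≠ 0 := fun h0 => by
      rw [sub_eq_zero.1 h0] at h3
      nlinarith [mul_self_nonneg (sign3 a b d)]
    have h5 := mem_openSegment_of_mul_neg (a := c) (b := d) h3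
    convert h5 using 1
    rw [hN, ← neg_sub (sign3 a b c), div_neg, neg_div_neg_eq]
    apply Prod.ext
    · simp only [Prod.fst_add, Prod.smul_fst, smul_eq_mul]
      field_simp
      unfold sign3; ring
    · simp only [Prod.snd_add, Prod.smul_snd, smul_eq_mul]
      field_simp
      unfold sign3; ring

lemma inter_openSegment_of_common {a b d : Pt} (h : sign3 a b d ≠ 0) :
    openSegment ℝ a b ∩ openSegment ℝ a d = ∅ := by
  rw [Set.eq_empty_iff_forall_notMem]
  rintro x ⟨hx, hx'⟩
  have := mul_neg_of_mem h hx ((openSegment_symm ℝ a d) ▸ hx')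
  have h0 : sign3 a b a = 0 := by unfold sign3; ring
  rw [h0, mul_zero] at this
  exact this.false

namespace ArcConfig

/-- A segment to a point off a chain from a chain point separating two other chain points does not
lie on a chain. -/
lemma not_outer_of_alt {α : Type} (K : ArcConfig α) {C : Finset α} (hC : C ∈ K.chains) {a b c d : α}
    (ha : a ∈ C) (hb : b ∈ C) (hc : c ∈ C) (hd : d ∉ C) (h : K.Alt a b c d) : ¬ K.Outer c d := by
  rintro ⟨D, hD, hcD, hdD⟩
  obtain ⟨haS, hbS, hcS, hdS⟩ := K.alt_mem h
  have hne : D ≠ C := by rintro rfl; exact hd hdD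
  obtain ⟨p, hp, q, hq, -, he, h2⟩ := K.ends C hC
  obtain ⟨r, -, -, -, hr⟩ := K.exists_rank haS
  have ea := h2 a ha d hdS hd
  have eb := h2 b hb d hdS hd
  have hac : a ≠ c := by rcases h with h | h; exacts [(K.ne h.1).1, (K.ne h.2).2.2.symm]
  have hbc : b ≠ c := by rcases h with h | h; exacts [(K.ne h.1).2.2.symm, (K.ne h.2).1]
  have hpS := K.sub C hC hp
  have hqS := K.sub C hC hq
  unfold Alt at h
  rw [hr _ haS _ hcS _ hbS, hr _ hbS _ hdS _ haS, hr _ haS _ hdS _ hbS, hr _ hbS _ hcS _ haS] at h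
  rw [hr _ hpS _ haS _ hqS, hr _ hqS _ hdS _ hpS, hr _ hpS _ hdS _ hqS, hr _ hqS _ haS _ hpS] at ea
  rw [hr _ hpS _ hbS _ hqS, hr _ hqS _ hdS _ hpS, hr _ hpS _ hdS _ hqS, hr _ hqS _ hbS _ hpS] at eb
  rcases he c hc D hD hne hcD with rfl | rfl
  · by_cases hbq : b = q
    · subst hbq
      by_cases haq : a = b
      · subst haq; unfold Cyc at *; omega
      have ea := ea hac haq
      unfold Cyc at *; omega
    by_cases haq : a = q
    · subst haq
      have eb := eb hbc hbq
      unfold Cyc at *; omega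
    have ea := ea hac haq
    have eb := eb hbc hbq
    unfold Cyc at *; omega
  · by_cases hbq : b = p
    · subst hbq
      by_cases haq : a = b
      · subst haq; unfold Cyc at *; omega
      have ea := ea haq hac
      unfold Cyc at *; omega
    by_cases haq : a = p
    · subst haq
      have eb := eb hbq hbc
      unfold Cyc at *; omega
    have ea := ea haq hac
    have eb := eb hbq hbc
    unfold Cyc at *; omega

end ArcConfig

namespace GDCOn

variable {S : Finset Pt} {g : GDCOn S} {hS : GenPos S}

lemma alt_iff {a b c d : Pt} (ha : a ∈ S) (hb : b ∈ S) (hc : c ∈ S) (hd : d ∈ S) (hab : a ≠ b)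
    (hac : a ≠ c) (had : a ≠ d) (hbc : b ≠ c) (hbd : b ≠ d)
    (hm : g.Mono a b c ↔ g.Mono a b d) :
    (g.config hS).Alt a b c d ↔ sign3 a b c * sign3 a b d < 0 := by
  have n1 := hS.sign3_ne ha hb hc hab hac hbc
  have n2 := hS.sign3_ne ha hb hd hab had hbd
  have m1 : g.Mono a c b ↔ g.Mono a b c := mono_swap
  have m2 : g.Mono b c a ↔ g.Mono a b c := mono_rot
  have m3 : g.Mono a d b ↔ g.Mono a b d := mono_swap
  have m4 : g.Mono b d a ↔ g.Mono a b d := mono_rot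
  simp only [ArcConfig.Alt, config, Btw, m1, m2, m3, m4, sign3_swap a b c, sign3_swap a b d,
    sign3_rot a b c, sign3_rot a b d, hm, mul_neg_iff]
  by_cases h : g.Mono a b d <;> simp [h, ha, hb, hc, hd, hab, hac, had, hbc, hbd, hab.symm,
    hac.symm, had.symm, hbc.symm, hbd.symm] <;> tauto

lemma cross_iff_alt {a b c d : Pt} (ha : a ∈ S) (hb : b ∈ S) (hc : c ∈ S) (hd : d ∈ S)
    (hab : a ≠ b) (hac : a ≠ c) (had : a ≠ d) (hbc : b ≠ c) (hbd : b ≠ d) (hcd : c ≠ d)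
    (hm : g.Mono a b c ↔ g.Mono a b d) (hm' : g.Mono c d a ↔ g.Mono c d b) :
    Cross a b c d ↔ (g.config hS).Alt a b c d := by
  rw [Cross, ← alt_iff (hS := hS) ha hb hc hd hab hac had hbc hbd hm,
    ← alt_iff (hS := hS) hc hd ha hb hcd hac.symm hbc.symm had.symm hbd.symm hm']
  exact ⟨fun h => h.1, fun h => ⟨h, ArcConfig.alt_symm _ h⟩⟩

lemma not_cross_of_three {C : Finset Pt} (hC : g.Big C) {a b c d : Pt} (hd : d ∈ S) (ha : a ∈ C)
    (hb : b ∈ C) (hc : c ∈ C) (hdC : d ∉ C) (hab : a ≠ b) (hac : a ≠ c) (hbc : b ≠ c)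
    (hS : GenPos S) : ¬ Cross a b c d := by
  rintro ⟨h1, h2⟩
  obtain ⟨p, q, hpq⟩ := g.chains_concave C hC.1
  have r1 := sign3_swap a b c
  have r2 := sign3_rot b a c
  have r4 := sign3_swap a b d
  have r5 := sign3_rot b a d
  have r7 : sign3 c d a = - sign3 a d c := by unfold sign3; ring
  have r8 : sign3 c d b = sign3 d b c := by unfold sign3; ring
  have r9 : sign3 b d c = - sign3 d b c := by unfold sign3; ring
  have r10 : sign3 d a c = - sign3 a d c := by unfold sign3; ring
  rw [r7, r8] at h2
  rcases (hS.sign3_ne (sub hC.1 ha) (sub hC.1 hb) (sub hC.1 hc) hab hac hbc).lt_or_gt with h | h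
  · rcases hpq.signs hS hb ha hc hab.symm hbc hac hd hdC (by linarith) with
      ⟨s1, s2, s3⟩ | ⟨s1, s2, s3⟩ | ⟨s1, s2, s3⟩ <;> nlinarith
  · rcases hpq.signs hS ha hb hc hab hac hbc hd hdC h with
      ⟨s1, s2, s3⟩ | ⟨s1, s2, s3⟩ | ⟨s1, s2, s3⟩ <;> nlinarith

lemma not_x_of_three {C : Finset Pt} (hC : g.Big C) {a b c d : Pt} (ha : a ∈ C)
    (hb : b ∈ C) (hc : c ∈ C) (hdC : d ∉ C) : ¬ (g.config hS).X a b c d := fun h =>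
  (g.config hS).not_outer_of_alt (C := C) hC ha hb hc hdC h.1 (h.2.1 ⟨C, hC, ha, hb⟩)

lemma cross_iff_x {a b c d : Pt} (ha : a ∈ S) (hb : b ∈ S) (hc : c ∈ S) (hd : d ∈ S)
    (hab : a ≠ b) (hac : a ≠ c) (had : a ≠ d) (hbc : b ≠ c) (hbd : b ≠ d) (hcd : c ≠ d) :
    Cross a b c d ↔ (g.config hS).X a b c d := by
  set K := g.config hS with hK
  have four : ∀ C, g.Big C → a ∈ C → b ∈ C → c ∈ C → d ∈ C → (Cross a b c d ↔ K.X a b c d) := by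
    intro C hC h1 h2 h3 h4
    rw [cross_iff_alt (hS := hS) (g := g) ha hb hc hd hab hac had hbc hbd hcd
      (iff_of_true ⟨C, hC, h1, h2, h3⟩ ⟨C, hC, h1, h2, h4⟩)
      (iff_of_true ⟨C, hC, h3, h4, h1⟩ ⟨C, hC, h3, h4, h2⟩)]
    exact (and_iff_left (iff_of_true ⟨C, hC, h1, h2⟩ ⟨C, hC, h3, h4⟩)).symm
  by_cases m1 : g.Mono a b c
  · obtain ⟨C, hC, h1, h2, h3⟩ := m1
    by_cases h4 : d ∈ C
    · exact four C hC h1 h2 h3 h4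
    · exact iff_of_false (not_cross_of_three hC hd h1 h2 h3 h4 hab hac hbc hS)
        (not_x_of_three hC h1 h2 h3 h4)
  by_cases m2 : g.Mono a b d
  · obtain ⟨C, hC, h1, h2, h3⟩ := m2
    have h4 : c ∉ C := fun h4 => m1 ⟨C, hC, h1, h2, h4⟩
    rw [← cross_comm_right, K.x_comm_right]
    exact iff_of_false (not_cross_of_three hC hc h1 h2 h3 h4 hab had hbd hS)
        (not_x_of_three hC h1 h2 h3 h4)
  have xs : K.X a b c d ↔ K.X c d a b := ⟨K.x_symm, K.x_symm⟩
  by_cases m3 : g.Mono c d a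
  · obtain ⟨C, hC, h1, h2, h3⟩ := m3
    have h4 : b ∉ C := fun h4 => m1 ⟨C, hC, h3, h4, h1⟩
    rw [← cross_symm, xs]
    exact iff_of_false (not_cross_of_three hC hb h1 h2 h3 h4 hcd hac.symm had.symm hS)
        (not_x_of_three hC h1 h2 h3 h4)
  by_cases m4 : g.Mono c d b
  · obtain ⟨C, hC, h1, h2, h3⟩ := m4
    have h4 : a ∉ C := fun h4 => m1 ⟨C, hC, h4, h3, h1⟩
    rw [← cross_symm, ← cross_comm_right, xs, K.x_comm_right]
    exact iff_of_false (not_cross_of_three hC ha h1 h2 h3 h4 hcd hbc.symm hbd.symm hS)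
        (not_x_of_three hC h1 h2 h3 h4)
  rw [cross_iff_alt (hS := hS) (g := g) ha hb hc hd hab hac had hbc hbd hcd
    (iff_of_false m1 m2) (iff_of_false m3 m4)]
  have no : ∀ {a b c d}, ¬ g.Mono a b c → ¬ g.Mono a b d → K.Alt a b c d → ¬ K.Outer a b := by
    rintro a b c d m1 m2 h ⟨C, hC, h1, h2⟩
    obtain ⟨-, -, hc, hd⟩ := K.alt_mem h
    have hcC : c ∉ C := fun h => m1 ⟨C, hC, h1, h2, h⟩
    have hdC : d ∉ C := fun h => m2 ⟨C, hC, h1, h2, h⟩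
    rcases h with h | h
    · exact K.contig C hC _ h1 _ h2 _ hc _ hd hcC hdC h.1 h.2
    · exact K.contig C hC _ h1 _ h2 _ hd _ hc hdC hcC h.1 h.2
  exact ⟨fun h => ⟨h, iff_of_false (no m1 m2 h) (no m3 m4 (K.alt_symm h))⟩, fun h => h.1⟩

lemma models_config (g : GDCOn S) (hS : GenPos S) : Models (g.config hS) := by
  intro a ha b hb c hc d hd hab hcd hne
  set K := g.config hS with hK
  have com : ∀ {a b d}, a ∈ S → b ∈ S → d ∈ S → a ≠ b → a ≠ d → b ≠ d →
      openSegment ℝ a b ∩ openSegment ℝ a d = ∅ := fun ha hb hd hab had hbd =>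
    inter_openSegment_of_common (hS.sign3_ne ha hb hd hab had hbd)
  by_cases hac : a = c
  · subst hac
    exact iff_of_true (com ha hb hd hab hcd fun h => hne (by rw [h])) K.not_x_self
  by_cases had : a = d
  · subst had
    rw [openSegment_symm ℝ c]
    exact iff_of_true (com ha hb hc hab hac fun h => hne (by rw [h, Sym2.eq_swap])) K.not_x_self'
  by_cases hbc : b = c
  · subst hbc
    rw [openSegment_symm ℝ a, K.x_comm_left]
    exact iff_of_true (com hb ha hd hab.symm hcd had) K.not_x_self
  by_cases hbd : b = d
  · subst hbd
    rw [openSegment_symm ℝ a, openSegment_symm ℝ c, K.x_comm_left]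
    exact iff_of_true (com hb ha hc hab.symm hbc hac) K.not_x_self'
  rw [inter_openSegment_eq_empty_iff (hS.sign3_ne ha hb hc hab hac hbc)
    (hS.sign3_ne hc hd ha hcd (Ne.symm hac) (Ne.symm had)),
    cross_iff_x (hS := hS) (g := g) ha hb hc hd hab hac had hbc hbd hcd]

end GDCOn

/-- For point sets in generalized double circle configuration, the flip graph on
all plane spanning paths is connected, with diameter `O(n²)`. -/
theorem stmt_16 :
    ∃ c : ℕ, ∀ S : Finset Pt, GenPos S → Nonempty (GDCOn S) →
      ∀ P Q : List Pt, IsPlanePath S P → IsPlanePath S Q →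
        ∃ k ≤ c * S.card ^ 2, FlipSeq S (fun _ => True) k P Q := by
  refine ⟨7, fun S hS ⟨g⟩ P Q hP hQ => ?_⟩
  by_cases hn : 3 ≤ S.card
  · exact near_of_models (g.models_config hS) hn hP hQ
  · obtain ⟨k, hk, h⟩ := near_of_edgeSet_eq hP (edgeSet_eq_of_card_le_two (by omega) hP hQ)
    exact ⟨k, hk.trans (Nat.zero_le _), h⟩
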